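/- arXiv:2109.02617 — 2 statements merged into one kernel-verified Lean document; each statement's English description precedes it below -/
import Mathlib

section
/- Let P be a simple polygon in the plane with vertices v_0, v_1, ..., v_{n-1} listed in order along its boundary. Then the vertices of P that lie on the boundary of the convex hull of {v_0, ..., v_{n-1}} appear in the same circular order along the boundary of P as they do along the boundary of the convex hull. -/
open Set

/-- Points in the plane. -/
abbrev Pt := ℝ × ℝ

/-- Orientation (twice signed area) of a triple of points. -/
noncomputable def orient (a b c : Pt) : ℝ :=
  (b.1 - a.1) * (c.2 - a.2) - (b.2 - a.2) * (c.1 - a.1)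

/-- A simple polygon: a cyclic sequence of at least three distinct vertices whose
consecutive-vertex edges meet only as forced (adjacent edges share exactly their
common vertex, non-adjacent edges are disjoint). -/
structure SimplePolygon where
  n : ℕ
  three_le : 3 ≤ n
  verts : ZMod n → Pt
  inj : Function.Injective verts
  edges_nonadj : ∀ i j : ZMod n, j ≠ i → j ≠ i + 1 → i ≠ j + 1 →
    segment ℝ (verts i) (verts (i + 1)) ∩ segment ℝ (verts j) (verts (j + 1)) = ∅
  edges_adj : ∀ i : ZMod n,
    segment ℝ (verts i) (verts (i + 1)) ∩ segment ℝ (verts (i + 1)) (verts (i + 1 + 1))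
      = {verts (i + 1)}

/-- The boundary curve of a simple polygon. -/
def SimplePolygon.boundary (P : SimplePolygon) : Set Pt :=
  ⋃ i : ZMod P.n, segment ℝ (P.verts i) (P.verts (i + 1))

/-- The interior region of a simple polygon: points off the boundary whose connected
component in the complement of the boundary is bounded. -/
def SimplePolygon.interiorRegion (P : SimplePolygon) : Set Pt :=
  {x | x ∉ P.boundary ∧ Bornology.IsBounded (connectedComponentIn P.boundaryᶜ x)}

/-- The exterior region of a simple polygon: points off the boundary whose connected
component in the complement of the boundary is unbounded. -/
def SimplePolygon.exteriorRegion (P : SimplePolygon) : Set Pt :=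
  {x | x ∉ P.boundary ∧ ¬ Bornology.IsBounded (connectedComponentIn P.boundaryᶜ x)}

/-- `v` is a vertex of the polygon `P`. -/
def SimplePolygon.IsVertex (P : SimplePolygon) (v : Pt) : Prop := v ∈ Set.range P.verts

/-- The (unordered) pair `u v` forms an edge of `P`. -/
def SimplePolygon.IsEdgeOf (P : SimplePolygon) (u v : Pt) : Prop :=
  ∃ i : ZMod P.n, (u = P.verts i ∧ v = P.verts (i + 1)) ∨ (v = P.verts i ∧ u = P.verts (i + 1))

/-- The segment `uv` is an internal diagonal of `P`: a segment joining two
non-adjacent vertices whose relative interior lies in the interior of `P`. -/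
def SimplePolygon.IsInternalDiagonal (P : SimplePolygon) (u v : Pt) : Prop :=
  P.IsVertex u ∧ P.IsVertex v ∧ u ≠ v ∧ ¬ P.IsEdgeOf u v ∧
    openSegment ℝ u v ⊆ P.interiorRegion

/-- The set `V(S)` of endpoints of a family of segments, each given by its pair of
endpoints. -/
def endpointSet (S : Finset (Pt × Pt)) : Set Pt :=
  {p | ∃ s ∈ S, p = s.1 ∨ p = s.2}

/-- `P` is a circumscribing polygon of `S`: the vertex set of `P` is `V(S)` and every
segment of `S` is an edge or an internal diagonal of `P`. -/
def Circumscribes (P : SimplePolygon) (S : Finset (Pt × Pt)) : Prop :=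
  Set.range P.verts = endpointSet S ∧
  ∀ s ∈ S, P.IsEdgeOf s.1 s.2 ∨ P.IsInternalDiagonal s.1 s.2

/-- The segments of `S` are nondegenerate and pairwise disjoint. -/
def PairwiseDisjointSegs (S : Finset (Pt × Pt)) : Prop :=
  (∀ s ∈ S, s.1 ≠ s.2) ∧
  ∀ s ∈ S, ∀ t ∈ S, s ≠ t →
    Disjoint (segment ℝ s.1 s.2) (segment ℝ t.1 t.2)

/-- All `2|S|` endpoints of the segments of `S` are distinct. -/
def DistinctEndpoints (S : Finset (Pt × Pt)) : Prop :=
  ∀ s ∈ S, ∀ t ∈ S, s.1 ≠ t.2 ∧ (s ≠ t → s.1 ≠ t.1 ∧ s.2 ≠ t.2)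

/-- The signed angle from the vector `x` to the vector `y`, with values in `(-π, π]`. -/
noncomputable def turn (x y : Pt) : ℝ :=
  Complex.arg ⟨x.1 * y.1 + x.2 * y.2, x.1 * y.2 - x.2 * y.1⟩

theorem turn_pos {x y : Pt} (h : 0 < x.1 * y.2 - x.2 * y.1) : 0 < turn x y := by
  refine lt_of_le_of_ne (Complex.arg_nonneg_iff.2 h.le) fun h0 => ?_
  have := (Complex.arg_eq_zero_iff.1 h0.symm).2
  exact h.ne' this

theorem turn_neg {x y : Pt} (h : x.1 * y.2 - x.2 * y.1 < 0) : turn x y < 0 :=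
  Complex.arg_neg_iff.2 h

/-- The angle of `x` measured from the direction representing the functional `f`. -/
noncomputable def angleFrom (f : Pt →L[ℝ] ℝ) (x : Pt) : ℝ :=
  Complex.arg ⟨f x, f (1, 0) * x.2 - f (0, 1) * x.1⟩

theorem functional_apply (f : Pt →L[ℝ] ℝ) (x : Pt) :
    f x = x.1 * f (1, 0) + x.2 * f (0, 1) := by
  have h : x = x.1 • ((1, 0) : Pt) + x.2 • ((0, 1) : Pt) := by ext <;> simp
  conv_lhs => rw [h]
  simp only [map_add, map_smul, smul_eq_mul]

theorem turn_eq_sub (f : Pt →L[ℝ] ℝ) {x y : Pt} (hx : 0 < f x) (hy : 0 < f y) :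
    turn x y = angleFrom f y - angleFrom f x := by
  set X : ℂ := ⟨f x, f (1, 0) * x.2 - f (0, 1) * x.1⟩ with hX
  set Y : ℂ := ⟨f y, f (1, 0) * y.2 - f (0, 1) * y.1⟩ with hY
  have hX0 : X ≠ 0 := fun h => hx.ne' (congrArg Complex.re h)
  have hY0 : Y ≠ 0 := fun h => hy.ne' (congrArg Complex.re h)
  have hXa := abs_lt.1 (Complex.abs_arg_lt_pi_div_two_iff.2 (Or.inl (show 0 < X.re from hx)))
  have hYa := abs_lt.1 (Complex.abs_arg_lt_pi_div_two_iff.2 (Or.inl (show 0 < Y.re from hy)))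
  have hconj : Complex.arg ((starRingEnd ℂ) X) = -Complex.arg X := by
    rw [Complex.arg_conj, if_neg]
    linarith [Real.pi_pos]
  have hmul : Complex.arg (Y * (starRingEnd ℂ) X) = Complex.arg Y - Complex.arg X := by
    rw [Complex.arg_mul hY0 (by simpa using hX0), hconj, sub_eq_add_neg]
    rw [hconj]
    constructor <;> linarith
  have hr : 0 < f (1, 0) ^ 2 + f (0, 1) ^ 2 := by
    rw [functional_apply] at hx
    by_contra h
    have h1 : f (1, 0) = 0 := by nlinarith [sq_nonneg (f (1, 0)), sq_nonneg (f (0, 1))]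
    have h2 : f (0, 1) = 0 := by nlinarith [sq_nonneg (f (1, 0)), sq_nonneg (f (0, 1))]
    simp [h1, h2] at hx
  have hprod : Y * (starRingEnd ℂ) X = ((f (1, 0) ^ 2 + f (0, 1) ^ 2 : ℝ) : ℂ) *
      ⟨x.1 * y.1 + x.2 * y.2, x.1 * y.2 - x.2 * y.1⟩ := by
    apply Complex.ext
    · simp only [hX, hY, Complex.mul_re, Complex.conj_re, Complex.conj_im, Complex.ofReal_re,
        Complex.ofReal_im, functional_apply f x, functional_apply f y]
      ring
    · simp only [hX, hY, Complex.mul_im, Complex.conj_re, Complex.conj_im, Complex.ofReal_re,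
        Complex.ofReal_im, functional_apply f x, functional_apply f y]
      ring
  rw [hprod, Complex.arg_real_mul _ hr] at hmul
  exact hmul

theorem sum_turn_eq (f : Pt →L[ℝ] ℝ) (z : ℕ → Pt) (q : ℕ) (hz : ∀ t ≤ q, 0 < f (z t)) :
    ∑ t ∈ Finset.range q, turn (z t) (z (t + 1)) = turn (z 0) (z q) := by
  rw [turn_eq_sub f (hz 0 (Nat.zero_le _)) (hz q le_rfl),
    ← Finset.sum_range_sub (fun t => angleFrom f (z t))]
  refine Finset.sum_congr rfl fun t ht => ?_
  have := Finset.mem_range.1 ht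
  exact turn_eq_sub f (hz t (by omega)) (hz (t + 1) (by omega))

/-- Discrete Stokes formula on a rectangular grid. -/
theorem sum_boundary_eq (H V : ℕ → ℕ → ℝ) (p q : ℕ)
    (h : ∀ s < p, ∀ t < q, H s t + V s (t + 1) = V s t + H (s + 1) t) :
    ∑ t ∈ Finset.range q, H 0 t + ∑ s ∈ Finset.range p, V s q =
      ∑ s ∈ Finset.range p, V s 0 + ∑ t ∈ Finset.range q, H p t := by
  have hrow : ∀ s < p, ∑ t ∈ Finset.range q, H (s + 1) t - ∑ t ∈ Finset.range q, H s t =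
      V s q - V s 0 := by
    intro s hs
    rw [← Finset.sum_range_sub (V s), ← Finset.sum_sub_distrib]
    refine Finset.sum_congr rfl fun t ht => ?_
    linarith [h s hs t (Finset.mem_range.1 ht)]
  have hcol := Finset.sum_range_sub (fun s => ∑ t ∈ Finset.range q, H s t) p
  rw [Finset.sum_congr rfl fun s hs => hrow s (Finset.mem_range.1 hs),
    Finset.sum_sub_distrib] at hcol
  linarith

theorem exists_pos_sub_of_disjoint_segment {a b c d : Pt}
    (h : Disjoint (segment ℝ a b) (segment ℝ c d)) :
    ∃ f : Pt →L[ℝ] ℝ, ∀ x ∈ segment ℝ a b, ∀ y ∈ segment ℝ c d, 0 < f (y - x) := by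
  have hc : ∀ u v : Pt, IsCompact (segment ℝ u v) := fun u v => by
    rw [← convexHull_pair]
    exact (Set.toFinite _).isCompact_convexHull ℝ
  obtain ⟨f, r, s, hr, hrs, hs⟩ := geometric_hahn_banach_compact_closed
    (convex_segment a b) (hc a b) (convex_segment c d) (hc c d).isClosed h
  refine ⟨f, fun x hx y hy => ?_⟩
  rw [map_sub]
  linarith [hr x hx, hs y hy]

/-- The angle relation around the four ends of two disjoint polygonal paths `x` and `w`, when
each end lies strictly on one side of the other path. -/
theorem turn_add_turn_eq_of_disjoint (x w : ℕ → Pt) (p q : ℕ)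
    (hd : ∀ s < p, ∀ t < q,
      Disjoint (segment ℝ (x s) (x (s + 1))) (segment ℝ (w t) (w (t + 1))))
    (ha : ∃ f : Pt →L[ℝ] ℝ, ∀ t ≤ q, 0 < f (w t - x 0))
    (hb : ∃ f : Pt →L[ℝ] ℝ, ∀ t ≤ q, 0 < f (w t - x p))
    (hc : ∃ f : Pt →L[ℝ] ℝ, ∀ s ≤ p, 0 < f (w 0 - x s))
    (hd' : ∃ f : Pt →L[ℝ] ℝ, ∀ s ≤ p, 0 < f (w q - x s)) :
    turn (w 0 - x 0) (w q - x 0) + turn (w q - x 0) (w q - x p) =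
      turn (w 0 - x 0) (w 0 - x p) + turn (w 0 - x p) (w q - x p) := by
  obtain ⟨fa, ha⟩ := ha
  obtain ⟨fb, hb⟩ := hb
  obtain ⟨fc, hc⟩ := hc
  obtain ⟨fd, hd'⟩ := hd'
  rw [← sum_turn_eq fa (fun t => w t - x 0) q ha, ← sum_turn_eq fb (fun t => w t - x p) q hb,
    ← sum_turn_eq fc (fun s => w 0 - x s) p hc, ← sum_turn_eq fd (fun s => w q - x s) p hd']
  refine sum_boundary_eq (fun s t => turn (w t - x s) (w (t + 1) - x s))
    (fun s t => turn (w t - x s) (w t - x (s + 1))) p q fun s hs t ht => ?_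
  obtain ⟨f, hf⟩ := exists_pos_sub_of_disjoint_segment (hd s hs t ht)
  have h00 := hf _ (left_mem_segment ..) _ (left_mem_segment ..)
  have h01 := hf _ (left_mem_segment ..) _ (right_mem_segment ..)
  have h10 := hf _ (right_mem_segment ..) _ (left_mem_segment ..)
  have h11 := hf _ (right_mem_segment ..) _ (right_mem_segment ..)
  rw [turn_eq_sub f h00 h01, turn_eq_sub f h01 h11, turn_eq_sub f h00 h10, turn_eq_sub f h10 h11]
  ring

theorem orient_rotate (a b c : Pt) : orient b c a = orient a b c := by
  simp only [orient]; ring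

theorem not_crossing_of_disjoint (x w : ℕ → Pt) (p q : ℕ)
    (hd : ∀ s < p, ∀ t < q,
      Disjoint (segment ℝ (x s) (x (s + 1))) (segment ℝ (w t) (w (t + 1))))
    (ha : ∃ f : Pt →L[ℝ] ℝ, ∀ t ≤ q, 0 < f (w t - x 0))
    (hb : ∃ f : Pt →L[ℝ] ℝ, ∀ t ≤ q, 0 < f (w t - x p))
    (hc : ∃ f : Pt →L[ℝ] ℝ, ∀ s ≤ p, 0 < f (w 0 - x s))
    (hd' : ∃ f : Pt →L[ℝ] ℝ, ∀ s ≤ p, 0 < f (w q - x s)) :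
    ¬ (0 < orient (x 0) (w 0) (w q) ∧ 0 < orient (x 0) (x p) (w q) ∧
        orient (x 0) (x p) (w 0) < 0 ∧ orient (x p) (w 0) (w q) < 0) ∧
    ¬ (orient (x 0) (w 0) (w q) < 0 ∧ orient (x 0) (x p) (w q) < 0 ∧
        0 < orient (x 0) (x p) (w 0) ∧ 0 < orient (x p) (w 0) (w q)) := by
  have key := turn_add_turn_eq_of_disjoint x w p q hd ha hb hc hd'
  simp only [orient]
  constructor
  · rintro ⟨h1, h2, h3, h4⟩
    have t1 : 0 < turn (w 0 - x 0) (w q - x 0) := turn_pos (by simp; linarith)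
    have t2 : 0 < turn (w q - x 0) (w q - x p) := turn_pos (by simp; linarith)
    have t3 : turn (w 0 - x 0) (w 0 - x p) < 0 := turn_neg (by simp; linarith)
    have t4 : turn (w 0 - x p) (w q - x p) < 0 := turn_neg (by simp; linarith)
    linarith
  · rintro ⟨h1, h2, h3, h4⟩
    have t1 : turn (w 0 - x 0) (w q - x 0) < 0 := turn_neg (by simp; linarith)
    have t2 : turn (w q - x 0) (w q - x p) < 0 := turn_neg (by simp; linarith)
    have t3 : 0 < turn (w 0 - x 0) (w 0 - x p) := turn_pos (by simp; linarith)
    have t4 : 0 < turn (w 0 - x p) (w q - x p) := turn_pos (by simp; linarith)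
    linarith

theorem exists_pos_sub_of_mem_extremePoints {S : Set Pt} (hS : S.Finite) {a : Pt}
    (ha : a ∈ Set.extremePoints ℝ (convexHull ℝ S)) :
    ∃ f : Pt →L[ℝ] ℝ, ∀ b ∈ S, b ≠ a → 0 < f (b - a) := by
  have hnot : a ∉ convexHull ℝ (S \ {a}) := fun h =>
    (((convex_convexHull ℝ S).mem_extremePoints_iff_mem_sdiff_convexHull_sdiff).1 ha).2
      (convexHull_mono (Set.sdiff_subset_sdiff_left (subset_convexHull ℝ S)) h)
  obtain ⟨f, r, hr, hs⟩ := geometric_hahn_banach_point_closed (convex_convexHull ℝ (S \ {a}))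
    ((hS.subset Set.sdiff_subset).isCompact_convexHull ℝ).isClosed hnot
  refine ⟨f, fun b hb hba => ?_⟩
  rw [map_sub]
  linarith [hs b (subset_convexHull ℝ _ ⟨hb, hba⟩)]

theorem orient_ne_zero {a b c : Pt}
    (ha : ∃ f : Pt →L[ℝ] ℝ, 0 < f (b - a) ∧ 0 < f (c - a))
    (hb : ∃ f : Pt →L[ℝ] ℝ, 0 < f (a - b) ∧ 0 < f (c - b))
    (hc : ∃ f : Pt →L[ℝ] ℝ, 0 < f (a - c) ∧ 0 < f (b - c)) : orient a b c ≠ 0 := by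
  intro h0
  obtain ⟨f, hf1, hf2⟩ := ha
  obtain ⟨g, hg1, hg2⟩ := hb
  obtain ⟨k, hk1, hk2⟩ := hc
  have key : ∀ m : Pt →L[ℝ] ℝ, f (b - a) * m (c - a) = f (c - a) * m (b - a) := by
    intro m
    simp only [orient] at h0
    rw [functional_apply f (b - a), functional_apply f (c - a), functional_apply m (b - a),
      functional_apply m (c - a)]
    simp only [Prod.fst_sub, Prod.snd_sub]
    linear_combination (f (1, 0) * m (0, 1) - f (0, 1) * m (1, 0)) * h0
  have kg := key g
  have kk := key k
  simp only [map_sub] at *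
  have h1 : f c - f a < f b - f a := by nlinarith
  have h2 : f b - f a < f c - f a := by nlinarith
  linarith

theorem barycentric_ne {a b c d : Pt}
    (hd : ∃ f : Pt →L[ℝ] ℝ, 0 < f (a - d) ∧ 0 < f (b - d) ∧ 0 < f (c - d)) :
    ¬ (0 < orient b c d ∧ 0 < orient c a d ∧ 0 < orient a b d) ∧
    ¬ (orient b c d < 0 ∧ orient c a d < 0 ∧ orient a b d < 0) := by
  obtain ⟨f, h1, h2, h3⟩ := hd
  have key : orient b c d * f (a - d) + orient c a d * f (b - d) + orient a b d * f (c - d) = 0 := by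
    rw [functional_apply f (a - d), functional_apply f (b - d), functional_apply f (c - d)]
    simp only [orient, Prod.fst_sub, Prod.snd_sub]
    ring
  constructor
  · rintro ⟨k1, k2, k3⟩
    linarith [mul_pos k1 h1, mul_pos k2 h2, mul_pos k3 h3]
  · rintro ⟨k1, k2, k3⟩
    linarith [mul_neg_of_neg_of_pos k1 h1, mul_neg_of_neg_of_pos k2 h2,
      mul_neg_of_neg_of_pos k3 h3]

namespace SimplePolygon

variable (P : SimplePolygon)

/-- The vertices of `P` listed periodically along the natural numbers. -/
def vertex (m : ℕ) : Pt := P.verts (m : ZMod P.n)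

theorem vertex_mem_range (m : ℕ) : P.vertex m ∈ Set.range P.verts := Set.mem_range_self _

theorem vertex_add_n (m : ℕ) : P.vertex (m + P.n) = P.vertex m := by simp [vertex]

theorem natCast_ne {a b : ℕ} (h : a < b) (h' : b < a + P.n) :
    (a : ZMod P.n) ≠ (b : ZMod P.n) := by
  intro hab
  have := (Nat.modEq_iff_dvd' h.le).1 ((ZMod.natCast_eq_natCast_iff _ _ _).1 hab)
  have := Nat.le_of_dvd (by omega) this
  omega

theorem vertex_ne {a b : ℕ} (h : a < b) (h' : b < a + P.n) : P.vertex a ≠ P.vertex b :=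
  fun e => P.natCast_ne h h' (P.inj e)

theorem disjoint_edges {a b : ℕ} (h : a + 1 < b) (h' : b + 1 < a + P.n) :
    Disjoint (segment ℝ (P.vertex a) (P.vertex (a + 1)))
      (segment ℝ (P.vertex b) (P.vertex (b + 1))) := by
  rw [Set.disjoint_iff_inter_eq_empty]
  have h1 := P.natCast_ne (show a < b by omega) (by omega)
  have h2 := P.natCast_ne h (by omega)
  have h3 := P.natCast_ne (show b + 1 < a + P.n by omega) (by omega)
  push_cast at h2 h3
  simp only [CharP.cast_eq_zero, add_zero] at h3
  have := P.edges_nonadj a b h1.symm h2.symm h3.symm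
  simpa only [vertex, Nat.cast_add, Nat.cast_one] using this

/-- The vertex is an extreme point of the convex hull. -/
def IsHullVertex (m : ℕ) : Prop :=
  P.vertex m ∈ Set.extremePoints ℝ (convexHull ℝ (Set.range P.verts))

variable {P}

theorem IsHullVertex.exists_pos {m : ℕ} (h : P.IsHullVertex m) :
    ∃ f : Pt →L[ℝ] ℝ, ∀ a, P.vertex a ≠ P.vertex m → 0 < f (P.vertex a - P.vertex m) := by
  have : NeZero P.n := ⟨by have := P.three_le; omega⟩
  obtain ⟨f, hf⟩ := exists_pos_sub_of_mem_extremePoints (Set.finite_range P.verts) h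
  exact ⟨f, fun a ha => hf _ (P.vertex_mem_range a) ha⟩

theorem IsHullVertex.exists_neg {m : ℕ} (h : P.IsHullVertex m) :
    ∃ f : Pt →L[ℝ] ℝ, ∀ a, P.vertex a ≠ P.vertex m → 0 < f (P.vertex m - P.vertex a) := by
  obtain ⟨f, hf⟩ := h.exists_pos
  refine ⟨-f, fun a ha => ?_⟩
  have := hf a ha
  simp only [neg_apply, map_sub] at *
  linarith

theorem not_crossing {i j k l : ℕ} (hij : i < j) (hjk : j < k) (hkl : k < l) (hli : l < i + P.n)
    (hi : P.IsHullVertex i) (hj : P.IsHullVertex j) (hk : P.IsHullVertex k)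
    (hl : P.IsHullVertex l) :
    ¬ (0 < orient (P.vertex i) (P.vertex k) (P.vertex l) ∧
        0 < orient (P.vertex i) (P.vertex j) (P.vertex l) ∧
        orient (P.vertex i) (P.vertex j) (P.vertex k) < 0 ∧
        orient (P.vertex j) (P.vertex k) (P.vertex l) < 0) ∧
    ¬ (orient (P.vertex i) (P.vertex k) (P.vertex l) < 0 ∧
        orient (P.vertex i) (P.vertex j) (P.vertex l) < 0 ∧
        0 < orient (P.vertex i) (P.vertex j) (P.vertex k) ∧
        0 < orient (P.vertex j) (P.vertex k) (P.vertex l)) := by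
  obtain ⟨p, rfl⟩ := Nat.exists_eq_add_of_lt hij
  obtain ⟨q, rfl⟩ := Nat.exists_eq_add_of_lt hkl
  obtain ⟨fi, hi⟩ := hi.exists_pos
  obtain ⟨fj, hj⟩ := hj.exists_pos
  obtain ⟨fk, hk⟩ := hk.exists_neg
  obtain ⟨fl, hl⟩ := hl.exists_neg
  refine not_crossing_of_disjoint (fun s => P.vertex (i + s)) (fun t => P.vertex (k + t))
    (p + 1) (q + 1) (fun s hs t ht => ?_) ⟨fi, fun t ht => ?_⟩ ⟨fj, fun t ht => ?_⟩
    ⟨fk, fun s hs => ?_⟩ ⟨fl, fun s hs => ?_⟩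
  · exact P.disjoint_edges (by omega) (by omega)
  · exact hi _ (P.vertex_ne (by omega) (by omega)).symm
  · exact hj _ (P.vertex_ne (by omega) (by omega)).symm
  · exact hk _ (P.vertex_ne (by omega) (by omega))
  · exact hl _ (P.vertex_ne (by omega) (by omega))

theorem orient_vertex_ne_zero {i j k : ℕ} (hij : i < j) (hjk : j < k) (hki : k < i + P.n)
    (hi : P.IsHullVertex i) (hj : P.IsHullVertex j) (hk : P.IsHullVertex k) :
    orient (P.vertex i) (P.vertex j) (P.vertex k) ≠ 0 := by
  have eij := P.vertex_ne hij (by omega)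
  have eik := P.vertex_ne (hij.trans hjk) hki
  have ejk := P.vertex_ne hjk (by omega)
  obtain ⟨fi, hi⟩ := hi.exists_pos
  obtain ⟨fj, hj⟩ := hj.exists_pos
  obtain ⟨fk, hk⟩ := hk.exists_pos
  exact orient_ne_zero ⟨fi, hi _ eij.symm, hi _ eik.symm⟩ ⟨fj, hj _ eij, hj _ ejk.symm⟩
    ⟨fk, hk _ eik, hk _ ejk⟩

/-- Four hull vertices in cyclic order along `P` span four triangles of the same orientation. -/
theorem orient_pos_iff_of_four {i j k l : ℕ} (hij : i < j) (hjk : j < k) (hkl : k < l)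
    (hli : l < i + P.n) (hi : P.IsHullVertex i) (hj : P.IsHullVertex j) (hk : P.IsHullVertex k)
    (hl : P.IsHullVertex l) :
    (0 < orient (P.vertex i) (P.vertex j) (P.vertex k) ↔
      0 < orient (P.vertex i) (P.vertex j) (P.vertex l)) ∧
    (0 < orient (P.vertex i) (P.vertex j) (P.vertex k) ↔
      0 < orient (P.vertex i) (P.vertex k) (P.vertex l)) ∧
    (0 < orient (P.vertex i) (P.vertex j) (P.vertex k) ↔
      0 < orient (P.vertex j) (P.vertex k) (P.vertex l)) := by
  have hi' : P.IsHullVertex (i + P.n) := by rwa [IsHullVertex, vertex_add_n]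
  have c1 := not_crossing hij hjk hkl hli hi hj hk hl
  have c2 := not_crossing hjk hkl hli (by omega) hj hk hl hi'
  have n1 := orient_vertex_ne_zero hij hjk (by omega) hi hj hk
  have n2 := orient_vertex_ne_zero hij (hjk.trans hkl) (by omega) hi hj hl
  have n3 := orient_vertex_ne_zero (hij.trans hjk) hkl (by omega) hi hk hl
  have n4 := orient_vertex_ne_zero hjk hkl (by omega) hj hk hl
  have eij := P.vertex_ne hij (by omega)
  have eik := P.vertex_ne (hij.trans hjk) (by omega)
  have eil := P.vertex_ne (hij.trans (hjk.trans hkl)) (by omega)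
  have ejk := P.vertex_ne hjk (by omega)
  have ejl := P.vertex_ne (hjk.trans hkl) (by omega)
  have ekl := P.vertex_ne hkl (by omega)
  obtain ⟨fi, hi⟩ := hi.exists_pos
  obtain ⟨fj, hj⟩ := hj.exists_pos
  obtain ⟨fk, hk⟩ := hk.exists_pos
  obtain ⟨fl, hl⟩ := hl.exists_pos
  have bi := barycentric_ne ⟨fi, hi _ eij.symm, hi _ eik.symm, hi _ eil.symm⟩
  have bj := barycentric_ne ⟨fj, hj _ eij, hj _ ejk.symm, hj _ ejl.symm⟩
  have bk := barycentric_ne ⟨fk, hk _ eik, hk _ ejk, hk _ ekl.symm⟩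
  have bl := barycentric_ne ⟨fl, hl _ eil, hl _ ejl, hl _ ekl⟩
  rw [vertex_add_n] at c2
  generalize P.vertex i = a at *
  generalize P.vertex j = b at *
  generalize P.vertex k = c at *
  generalize P.vertex l = d at *
  have hsum : orient a b c + orient a c d = orient a b d + orient b c d := by
    simp only [orient]; ring
  have r1 : orient b d a = orient a b d := orient_rotate ..
  have r2 : orient b c a = orient a b c := orient_rotate ..
  have r3 : orient c d a = orient a c d := orient_rotate ..
  have r4 : orient d b a = -orient a b d := by simp only [orient]; ring
  have r5 : orient c d b = orient b c d := orient_rotate ..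
  have r6 : orient d a b = orient a b d := (orient_rotate ..).symm
  have r7 : orient a c b = -orient a b c := by simp only [orient]; ring
  have r8 : orient b d c = -orient b c d := by simp only [orient]; ring
  have r9 : orient d a c = orient a c d := by simp only [orient]; ring
  have r10 : orient c a d = -orient a c d := by simp only [orient]; ring
  rw [r1, r2, r3] at c2
  rw [r2, r3, r4] at bi
  rw [r5, r6, r7] at bj
  rw [r8, r9] at bk
  rw [r10] at bl
  generalize orient a b c = s1 at *
  generalize orient a b d = s2 at *
  generalize orient a c d = s3 at *
  generalize orient b c d = s4 at *
  clear r1 r2 r3 r4 r5 r6 r7 r8 r9 r10 hi hj hk hl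
  rcases lt_or_gt_of_ne n1 with h1 | h1 <;> rcases lt_or_gt_of_ne n2 with h2 | h2 <;>
  rcases lt_or_gt_of_ne n3 with h3 | h3 <;> rcases lt_or_gt_of_ne n4 with h4 | h4 <;>
  first
  | (refine ⟨⟨?_, ?_⟩, ⟨?_, ?_⟩, ⟨?_, ?_⟩⟩ <;> intro <;> linarith)
  | (exfalso; simp_all)

theorem orient_pos_iff {i j k i' j' k' : ℕ} (hij : i < j) (hjk : j < k) (hk : k < P.n)
    (hij' : i' < j') (hjk' : j' < k') (hk' : k' < P.n)
    (ei : P.IsHullVertex i) (ej : P.IsHullVertex j) (ek : P.IsHullVertex k)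
    (ei' : P.IsHullVertex i') (ej' : P.IsHullVertex j') (ek' : P.IsHullVertex k') :
    0 < orient (P.vertex i) (P.vertex j) (P.vertex k) ↔
      0 < orient (P.vertex i') (P.vertex j') (P.vertex k') := by
  have replace_first : ∀ {m i j k : ℕ}, m ≤ i → i < j → j < k → k < P.n → P.IsHullVertex m →
      P.IsHullVertex i → P.IsHullVertex j → P.IsHullVertex k →
      (0 < orient (P.vertex i) (P.vertex j) (P.vertex k) ↔
        0 < orient (P.vertex m) (P.vertex j) (P.vertex k)) := by
    intro m i j k hmi hij hjk hk em ei ej ek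
    rcases hmi.eq_or_lt with rfl | hmi
    · rfl
    · have := orient_pos_iff_of_four hmi hij hjk (by omega) em ei ej ek
      tauto
  have middle : ∀ {m j j' k : ℕ}, m < j → j ≤ j' → j' < k → k < P.n → P.IsHullVertex m →
      P.IsHullVertex j → P.IsHullVertex j' → P.IsHullVertex k →
      (0 < orient (P.vertex m) (P.vertex j) (P.vertex k) ↔
        0 < orient (P.vertex m) (P.vertex j') (P.vertex k)) := by
    intro m j j' k hmj hj hjk hk em ej ej' ek
    rcases hj.eq_or_lt with rfl | hj
    · rfl
    · have := orient_pos_iff_of_four hmj hj hjk (by omega) em ej ej' ek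
      tauto
  have last : ∀ {m j k l : ℕ}, m < j → j < k → k ≤ l → l < P.n → P.IsHullVertex m →
      P.IsHullVertex j → P.IsHullVertex k → P.IsHullVertex l →
      (0 < orient (P.vertex m) (P.vertex j) (P.vertex k) ↔
        0 < orient (P.vertex m) (P.vertex j) (P.vertex l)) := by
    intro m j k l hmj hjk hkl hl em ej ek el
    rcases hkl.eq_or_lt with rfl | hkl
    · rfl
    · exact (orient_pos_iff_of_four hmj hjk hkl (by omega) em ej ek el).1
  obtain ⟨m, hm, hm', em⟩ : ∃ m, m ≤ i ∧ m ≤ i' ∧ P.IsHullVertex m := by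
    rcases le_total i i' with h | h
    · exact ⟨i, le_rfl, h, ei⟩
    · exact ⟨i', h, le_rfl, ei'⟩
  obtain ⟨l, hl, hl', hln, el⟩ : ∃ l, k ≤ l ∧ k' ≤ l ∧ l < P.n ∧ P.IsHullVertex l := by
    rcases le_total k k' with h | h
    · exact ⟨k', h, le_rfl, hk', ek'⟩
    · exact ⟨k, le_rfl, h, hk, ek⟩
  have hmid : 0 < orient (P.vertex m) (P.vertex j) (P.vertex l) ↔
      0 < orient (P.vertex m) (P.vertex j') (P.vertex l) := by
    rcases le_total j j' with h | h
    · exact middle (by omega) h (by omega) hln em ej ej' el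
    · exact (middle (by omega) h (by omega) hln em ej' ej el).symm
  rw [replace_first hm hij hjk hk em ei ej ek, replace_first hm' hij' hjk' hk' em ei' ej' ek',
    last (by omega) hjk hl hln em ej ek el, last (by omega) hjk' hl' hln em ej' ek' el, hmid]

theorem vertex_val [NeZero P.n] (i : ZMod P.n) : P.vertex i.val = P.verts i := by
  rw [vertex, ZMod.natCast_zmod_val]

end SimplePolygon

theorem ZMod.val_sub_add_val {n : ℕ} [NeZero n] (i j : ZMod n) :
    (j - i).val + i.val = j.val ∨ (j - i).val + i.val = j.val + n := by
  rcases lt_or_ge ((j - i).val + i.val) n with h | h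
  · left
    rw [← ZMod.val_add_of_lt h, sub_add_cancel]
  · right
    rw [ZMod.val_add_val_of_le h, sub_add_cancel]

/-- A cyclically ordered triple of residues is a rotation of an increasing one. -/
theorem ZMod.val_lt_rotations {n : ℕ} [NeZero n] {i j k : ZMod n} (hij : i ≠ j)
    (h : (j - i).val < (k - i).val) :
    (i.val < j.val ∧ j.val < k.val) ∨ (j.val < k.val ∧ k.val < i.val) ∨
      (k.val < i.val ∧ i.val < j.val) := by
  have h1 := ZMod.val_sub_add_val i j
  have h2 := ZMod.val_sub_add_val i k
  have h3 : i.val ≠ j.val := fun e => hij (ZMod.val_injective n e)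
  have := ZMod.val_lt i
  have := ZMod.val_lt j
  have := ZMod.val_lt k
  have := ZMod.val_lt (j - i)
  have := ZMod.val_lt (k - i)
  omega

/-- The vertices of a simple polygon `P` that are extreme points of the convex hull of
its vertex set appear in the same circular order along `P` as along the hull boundary:
the cyclic order of the polygon's indexing agrees (consistently, up to a global choice
of orientation) with the counterclockwise order on the hull, expressed via `orient`. -/
theorem vertices_on_hull_same_circular_order (P : SimplePolygon)
    (E : Set (ZMod P.n))
    (hE : E = {i | P.verts i ∈ Set.extremePoints ℝ (convexHull ℝ (Set.range P.verts))}) :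
    (∀ i ∈ E, ∀ j ∈ E, ∀ k ∈ E, i ≠ j → j ≠ k → i ≠ k →
      (j - i).val < (k - i).val → 0 < orient (P.verts i) (P.verts j) (P.verts k)) ∨
    (∀ i ∈ E, ∀ j ∈ E, ∀ k ∈ E, i ≠ j → j ≠ k → i ≠ k →
      (j - i).val < (k - i).val → orient (P.verts i) (P.verts j) (P.verts k) < 0) := by
  have : NeZero P.n := ⟨by have := P.three_le; omega⟩
  have hull : ∀ i ∈ E, P.IsHullVertex i.val := by
    intro i hi
    rw [hE] at hi
    rw [SimplePolygon.IsHullVertex, SimplePolygon.vertex_val]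
    exact hi
  have sorted : ∀ i ∈ E, ∀ j ∈ E, ∀ k ∈ E, i ≠ j → (j - i).val < (k - i).val →
      ∃ a b c : ℕ, a < b ∧ b < c ∧ c < P.n ∧ P.IsHullVertex a ∧ P.IsHullVertex b ∧
        P.IsHullVertex c ∧ orient (P.verts i) (P.verts j) (P.verts k) =
          orient (P.vertex a) (P.vertex b) (P.vertex c) := by
    intro i hi j hj k hk hij h
    simp only [← SimplePolygon.vertex_val]
    rcases ZMod.val_lt_rotations hij h with h | h | h
    · exact ⟨_, _, _, h.1, h.2, ZMod.val_lt _, hull i hi, hull j hj, hull k hk, rfl⟩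
    · exact ⟨_, _, _, h.1, h.2, ZMod.val_lt _, hull j hj, hull k hk, hull i hi,
        (orient_rotate _ _ _).symm⟩
    · exact ⟨_, _, _, h.1, h.2, ZMod.val_lt _, hull k hk, hull i hi, hull j hj,
        orient_rotate _ _ _⟩
  by_cases hpos : ∃ a b c : ℕ, a < b ∧ b < c ∧ c < P.n ∧ P.IsHullVertex a ∧ P.IsHullVertex b ∧
      P.IsHullVertex c ∧ 0 < orient (P.vertex a) (P.vertex b) (P.vertex c)
  · left
    obtain ⟨a', b', c', hab', hbc', hc', ea', eb', ec', hpos⟩ := hpos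
    intro i hi j hj k hk hij _ _ h
    obtain ⟨a, b, c, hab, hbc, hc, ea, eb, ec, e⟩ := sorted i hi j hj k hk hij h
    rw [e, SimplePolygon.orient_pos_iff hab hbc hc hab' hbc' hc' ea eb ec ea' eb' ec']
    exact hpos
  · right
    intro i hi j hj k hk hij _ _ h
    obtain ⟨a, b, c, hab, hbc, hc, ea, eb, ec, e⟩ := sorted i hi j hj k hk hij h
    rw [e]
    refine lt_of_le_of_ne (not_lt.1 fun hlt => hpos ⟨a, b, c, hab, hbc, hc, ea, eb, ec, hlt⟩) ?_
    exact SimplePolygon.orient_vertex_ne_zero hab hbc (by omega) ea eb ec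
end

section
/- There exists a family of 17 pairwise disjoint closed axis-parallel segments in the plane, not all contained in one line, that does not admit a circumscribing polygon. -/
open Set

namespace Config

/-- The abscissas of the 34 endpoints. The endpoints 2 to 17 lie in the right half and their mirror
images are 18 to 33; the dividing segment joins 0 and 1. -/
def xs : List ℕ := [50, 50, 90, 80, 96, 96, 59, 94, 70, 70, 100, 100, 63, 91, 64, 64, 66, 88,
  10, 20, 4, 4, 41, 6, 30, 30, 0, 0, 37, 9, 36, 36, 34, 12]

/-- The ordinates of the 34 endpoints. -/
def ys : List ℕ := [56, 2, 57, 1, 52, 8, 30, 30, 33, 53, 11, 27, 23, 23, 45, 38, 27, 27,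
  57, 1, 52, 8, 30, 30, 33, 53, 11, 27, 23, 23, 45, 38, 27, 27]

def px (i : ℕ) : ℕ := xs.getD i 0
def py (i : ℕ) : ℕ := ys.getD i 0

/-- Whether the triple of vertices `a b c` turns left. -/
def pos (a b c : ℕ) : Bool :=
  Nat.blt (Nat.add (Nat.mul (px b) (py a)) (Nat.add (Nat.mul (px c) (py b)) (Nat.mul (px a) (py c))))
    (Nat.add (Nat.mul (px a) (py b)) (Nat.add (Nat.mul (px b) (py c)) (Nat.mul (px c) (py a))))

/-- Whether the segments `ab` and `cd` cross properly. -/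
def cr (a b c d : ℕ) : Bool :=
  ((pos a b c && pos b a d) || (pos b a c && pos a b d)) &&
    ((pos c d a && pos d c b) || (pos d c a && pos c d b))

/-- The other endpoint of the segment with endpoint `v`. -/
def partner (v : ℕ) : ℕ :=
  [1, 0, 18, 19, 5, 4, 7, 6, 9, 8, 11, 10, 13, 12, 15, 14, 17, 16,
    2, 3, 21, 20, 23, 22, 25, 24, 27, 26, 29, 28, 31, 30, 33, 32].getD v 0

/-- `List.all`, written with recursors so that the kernel evaluates it quickly. -/
def allRec {α : Type} (p : α → Bool) (l : List α) : Bool :=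
  List.rec true (fun a _ ih => Bool.rec false ih (p a)) l

/-- The family of segments, as pairs of endpoint indices. -/
def segs : List (ℕ × ℕ) := [(0, 1), (2, 18), (3, 19), (4, 5), (6, 7), (8, 9), (10, 11), (12, 13),
  (14, 15), (16, 17), (20, 21), (22, 23), (24, 25), (26, 27), (28, 29), (30, 31), (32, 33)]

/-- Whether the segment `ab` crosses no segment of the family properly. -/
def sees (a b : ℕ) : Bool := allRec (fun s => !cr a b s.1 s.2) segs

/-- Whether the segment at `v` leaves `v` to the left of the turn `u v w`. -/
def coneBad (u v w : ℕ) : Bool :=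
  !Nat.beq (partner v) u && !Nat.beq (partner v) w &&
    bif pos u v w then pos u v (partner v) && pos v w (partner v)
    else pos u v (partner v) || pos v w (partner v)

/-- The endpoints in the right half, those of the dividing segment included. -/
def right : List ℕ := [0, 1, 2, 3, 4, 5, 6, 7, 8, 9, 10, 11, 12, 13, 14, 15, 16, 17]

def nbrs (v : ℕ) : List ℕ := right.filter fun w => !Nat.beq v w && sees v w

/-- Sets of numbers are represented by their bit masks. -/
def bit (i : ℕ) : ℕ := Nat.shiftLeft 1 i

def arc (v w : ℕ) : ℕ := bit (Nat.add (Nat.mul 18 v) w)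

/-- The union of the bit masks `p a`, for `a` in `l`. -/
def sumRec {α : Type} (p : α → ℕ) (l : List α) : ℕ :=
  List.rec 0 (fun a _ ih => Nat.lor (p a) ih) l

/-- The arcs that cannot be used together with the arc `vw`. -/
def conflicts (v w : ℕ) : ℕ :=
  sumRec (fun x => sumRec (fun y => bif Nat.beq y w || cr v w x y then arc x y else 0) (nbrs x)) right

/-- The vertices that may follow the arc `uv`. -/
def next (u v : ℕ) : List ℕ :=
  (nbrs v).filter fun w => !Nat.beq w 0 && !Nat.beq w 2 && !coneBad u v w

/-- Whether every extension of the arc `uv` to a path ending in `goal` that avoids the arcs in `forb`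
satisfies `fin`, which receives the forbidden arcs and the vertices visited. -/
def refute (goal : ℕ) (fin : ℕ → ℕ → Bool) (fuel : ℕ) : ℕ → ℕ → ℕ → ℕ → Bool :=
  Nat.rec (fun _ _ _ _ => false) (fun _ ih u v forb vis =>
    Bool.rec (Bool.rec (allRec (fun w =>
      Bool.rec true (ih v w (Nat.lor forb (conflicts v w)) (Nat.lor vis (bit w)))
         (Nat.beq 0 (Nat.land forb (arc v w)))) (next u v))
       true (Nat.beq v 3)) (fin forb vis) (Nat.beq v goal)) fuel

/-- Whether the set `vis` misses one of the vertices 4 to 17. -/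
def incomplete (_ vis : ℕ) : Bool := !Nat.beq 262128 (Nat.land vis 262128)

/-- Whether no path in the right half from top to bottom visits all of the right half. -/
def refuteDirect : Bool :=
  allRec (fun w => Nat.beq w 0 || refute 3 incomplete 34 2 w (conflicts 2 w) (bit w)) (nbrs 2)

/-- Whether no two compatible paths in the right half, from the top to 1 and from 0 to the bottom,
visit all of the right half. -/
def refuteDetour : Bool :=
  allRec (fun w => Nat.beq w 0 || refute 1 (fun forb vis =>
    allRec (fun w => Nat.beq w 1 || !Nat.beq 0 (Nat.land forb (arc 0 w)) ||
      refute 3 incomplete 34 0 w (Nat.lor forb (conflicts 0 w)) (Nat.lor vis (bit w))) (nbrs 0))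
    34 2 w (conflicts 2 w) (bit w)) (nbrs 2)

theorem refuteDirect_eq_true : refuteDirect = true := by decide +kernel

theorem refuteDetour_eq_true : refuteDetour = true := by decide +kernel

theorem beq_eq_false {a b : ℕ} : Nat.beq a b = false ↔ a ≠ b := by
  rw [← Bool.not_eq_true, Nat.beq_eq]

theorem allRec_iff {α : Type} (p : α → Bool) (l : List α) :
    allRec p l = true ↔ ∀ a ∈ l, p a = true := by
  induction l with
  | nil => simp [allRec]
  | cons a l ih =>
    have h : allRec p (a :: l) = (p a && allRec p l) := by
      change Bool.rec (motive := fun _ => Bool) false (allRec p l) (p a) = _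
      cases p a <;> rfl
    simp [h, ih]

theorem testBit_sumRec {α : Type} (p : α → ℕ) (l : List α) (i : ℕ) :
    (sumRec p l).testBit i = true ↔ ∃ a ∈ l, (p a).testBit i = true := by
  induction l with
  | nil => simp [sumRec]
  | cons a l ih =>
    have h : sumRec p (a :: l) = p a ||| sumRec p l := rfl
    simp [h, Nat.testBit_or, ih]

theorem testBit_bit (i j : ℕ) : (bit i).testBit j = true ↔ i = j := by
  have h : bit i = 2 ^ i := by simp [bit, Nat.shiftLeft_eq]
  simp [h, Nat.testBit_two_pow]

theorem mem_right {v : ℕ} : v ∈ right ↔ v < 18 := by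
  simp only [right, List.mem_cons, List.not_mem_nil, or_false]
  omega

theorem mem_nbrs {v w : ℕ} : w ∈ nbrs v ↔ w < 18 ∧ v ≠ w ∧ sees v w = true := by
  rw [nbrs, List.mem_filter, mem_right]
  simp only [Bool.and_eq_true, Bool.not_eq_true', beq_eq_false]

theorem arc_avail {forb v w : ℕ} :
    Nat.beq 0 (Nat.land forb (arc v w)) = true ↔ forb.testBit (18 * v + w) = false := by
  have h : arc v w = 2 ^ (18 * v + w) := by simp [arc, bit, Nat.shiftLeft_eq]
  have h' : Nat.land forb (arc v w) = (forb.testBit (18 * v + w)).toNat * 2 ^ (18 * v + w) := by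
    rw [h]; exact Nat.and_two_pow _ _
  rw [h', Nat.beq_eq]
  cases forb.testBit (18 * v + w) <;> simp [(Nat.two_pow_pos _).ne]

theorem conflicts_sound {v w x y : ℕ} (hy : y < 18)
    (h : (conflicts v w).testBit (18 * x + y) = true) : y = w ∨ cr v w x y = true := by
  simp only [conflicts, testBit_sumRec, mem_nbrs] at h
  obtain ⟨a, -, b, ⟨hb, -⟩, h⟩ := h
  cases hc : (Nat.beq b w || cr v w a b) with
  | false => simp [hc] at h
  | true =>
    rw [hc] at h
    have := (testBit_bit _ _).1 h
    change 18 * a + b = 18 * x + y at this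
    obtain ⟨rfl, rfl⟩ : a = x ∧ b = y := by omega
    simpa using hc

theorem mem_next {u v w : ℕ} : w ∈ next u v ↔
    w ∈ nbrs v ∧ w ≠ 0 ∧ w ≠ 2 ∧ coneBad u v w = false := by
  rw [next, List.mem_filter]
  simp [and_assoc, beq_eq_false]

/-- A cyclic order of the vertices, read off from the edge joining the two top vertices. -/
structure Tour (f : ℕ → ℕ) : Prop where
  lt : ∀ i < 34, f i < 34
  inj : ∀ i < 34, ∀ j < 34, f i = f j → i = j
  zero : f 0 = 2
  last : f 33 = 18
  sees : ∀ i < 33, sees (f i) (f (i + 1)) = true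
  cross : ∀ i < 33, ∀ j < 33, cr (f i) (f (i + 1)) (f j) (f (j + 1)) = false
  cone : ∀ i < 32, coneBad (f i) (f (i + 1)) (f (i + 2)) = false
  base : ∃ i < 33, (f i = 3 ∧ f (i + 1) = 19) ∨ (f i = 19 ∧ f (i + 1) = 3)

theorem Tour.not_conflict {f : ℕ → ℕ} (hf : Tour f) {j k : ℕ} (hj : j < 33) (hk : k < 33)
    (hjk : j ≠ k) (h : f (j + 1) < 18) :
    (conflicts (f k) (f (k + 1))).testBit (18 * f j + f (j + 1)) = false := by
  by_contra! hc
  rcases conflicts_sound h (by simpa using hc) with h' | h'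
  · have := hf.inj _ (by omega) _ (by omega) h'
    omega
  · simp [hf.cross k hk j hj] at h'

theorem Tour.refute_sound {f : ℕ → ℕ} (hf : Tour f) {goal m : ℕ} {fin : ℕ → ℕ → Bool}
    {E : ℕ → Prop} (hm : f m = goal) (hm' : m < 34)
    (hE : ∀ j, E j → m ≤ j ∧ j < 33 ∧ f (j + 1) < 18) (fuel i forb vis : ℕ) (him : i < m)
    (hfuel : m - i ≤ fuel)
    (hpath : ∀ j, i < j → j ≤ m → f j < 18 ∧ f j ≠ 0 ∧ f j ≠ 2 ∧ (j < m → f j ≠ 3))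
    (hforb : ∀ j, i < j ∧ j < m ∨ E j → forb.testBit (18 * f j + f (j + 1)) = false)
    (h : refute goal fin fuel (f i) (f (i + 1)) forb vis = true) :
    ∃ forb' vis', fin forb' vis' = true ∧
      (∀ j, E j → forb'.testBit (18 * f j + f (j + 1)) = false) ∧
      (∀ x, vis.testBit x = true → vis'.testBit x = true) ∧
      ∀ j, i + 1 < j → j ≤ m → vis'.testBit (f j) = true := by
  induction fuel generalizing i forb vis with
  | zero => omega
  | succ k ih =>
    have hstep : refute goal fin (k + 1) (f i) (f (i + 1)) forb vis =
      bif Nat.beq (f (i + 1)) goal then fin forb vis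
      else bif Nat.beq (f (i + 1)) 3 then true
      else allRec (fun w => bif Nat.beq 0 (Nat.land forb (arc (f (i + 1)) w)) then
        refute goal fin k (f (i + 1)) w (Nat.lor forb (conflicts (f (i + 1)) w))
          (Nat.lor vis (bit w)) else true) (next (f i) (f (i + 1))) := by
      conv_lhs => unfold refute
      simp only
      cases Nat.beq (f (i + 1)) goal <;> cases Nat.beq (f (i + 1)) 3 <;> try rfl
      refine congrArg (allRec · _) (funext fun w => ?_)
      cases Nat.beq 0 (Nat.land forb (arc (f (i + 1)) w)) <;> rfl
    rw [hstep] at h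
    by_cases hg : i + 1 = m
    · subst hg
      rw [hm] at h
      simp only [Nat.beq_refl, cond_true] at h
      exact ⟨forb, vis, h, fun j hj => hforb j (Or.inr hj), fun _ hx => hx, fun j _ _ => by omega⟩
    · have hg' : Nat.beq (f (i + 1)) goal = false := by
        rw [beq_eq_false]
        intro hc
        have := hf.inj _ (by omega) _ (by omega) (hc.trans hm.symm)
        omega
      have h3 : Nat.beq (f (i + 1)) 3 = false := by
        rw [beq_eq_false]
        exact (hpath (i + 1) (by omega) (by omega)).2.2.2 (by omega)
      rw [hg', h3, cond_false, cond_false, allRec_iff] at h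
      obtain ⟨hlt, h0, h2, -⟩ := hpath (i + 2) (by omega) (by omega)
      have hne : f (i + 1) ≠ f (i + 2) := fun hc => by
        have := hf.inj _ (by omega) _ (by omega) hc
        omega
      have hmem : f (i + 2) ∈ next (f i) (f (i + 1)) := by
        rw [mem_next, mem_nbrs]
        exact ⟨⟨hlt, hne, hf.sees (i + 1) (by omega)⟩, h0, h2, hf.cone i (by omega)⟩
      have h' := h _ hmem
      rw [arc_avail.2 (hforb (i + 1) (Or.inl (by omega))), cond_true] at h'
      obtain ⟨forb', vis', hfin, hforb', hvis, htr⟩ := ih (i + 1) _ _ (by omega) (by omega)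
        (fun j hj => hpath j (by omega)) (fun j hj => by
          change Nat.testBit (_ ||| _) _ = false
          rw [Nat.testBit_or, hforb j (hj.imp_left (by omega)), Bool.false_or]
          rcases hj with hj | hj
          · exact hf.not_conflict (by omega) (by omega) (by omega)
              (hpath (j + 1) (by omega) (by omega)).1
          · have := hE j hj
            exact hf.not_conflict (by omega) (by omega) (by omega) this.2.2) h'
      have hvis' : ∀ x, vis.testBit x = true ∨ f (i + 2) = x → vis'.testBit x = true := by
        intro x hx
        refine hvis x ?_
        change Nat.testBit (_ ||| _) _ = true
        rw [Nat.testBit_or, Bool.or_eq_true, testBit_bit]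
        exact hx
      refine ⟨forb', vis', hfin, hforb', fun x hx => hvis' x (Or.inl hx), fun j hj hjm => ?_⟩
      by_cases hj' : j = i + 2
      · exact hvis' _ (Or.inr (by rw [hj']))
      · exact htr j (by omega) hjm

theorem exists_testBit_eq_false {forb vis : ℕ} (h : incomplete forb vis = true) :
    ∃ v, 4 ≤ v ∧ v < 18 ∧ vis.testBit v = false := by
  by_contra! hc
  rw [incomplete, Bool.not_eq_true', beq_eq_false] at h
  refine h (Eq.symm (Nat.eq_of_testBit_eq fun v => ?_))
  have h' : 262128 = (2 ^ 14 - 1) <<< 4 := rfl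
  change Nat.testBit (vis &&& 262128) v = _
  rw [Nat.testBit_and, h', Nat.testBit_shiftLeft, Nat.testBit_two_pow_sub_one]
  by_cases hv : 4 ≤ v ∧ v < 18
  · simp [hc v hv.1 hv.2]
  · have : (decide (v ≥ 4) && decide (v - 4 < 14)) = false := by
      simp only [Bool.and_eq_false_iff, decide_eq_false_iff_not]
      omega
    simp [this]

/-- A tour has no initial stretch that runs through the whole right half to its bottom vertex. -/
theorem Tour.not_direct {f : ℕ → ℕ} (hf : Tour f) {c : ℕ} (hc : c < 33) (hfc : f c = 3)
    (hpath : ∀ j ≤ c, f j < 18 ∧ f j ≠ 0)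
    (hcover : ∀ v, 4 ≤ v → v < 18 → ∃ j ≤ c, f j = v) : False := by
  have h := refuteDirect_eq_true
  have hc0 : 0 < c := Nat.pos_of_ne_zero fun h => by simp [h, hf.zero] at hfc
  have hmem : f 1 ∈ nbrs 2 := by
    have := hf.sees 0 (by omega)
    rw [hf.zero] at this
    refine mem_nbrs.2 ⟨(hpath 1 (by omega)).1, fun h => ?_, this⟩
    have := hf.inj 0 (by omega) 1 (by omega) (by rw [hf.zero, h])
    omega
  have h1 := (allRec_iff _ _).1 h _ hmem
  rw [Bool.or_eq_true, Nat.beq_eq, or_iff_right (hpath 1 (by omega)).2] at h1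
  nth_rewrite 1 [← hf.zero] at h1
  obtain ⟨forb, vis, hfin, -, hvis, htr⟩ := hf.refute_sound hfc (by omega) (E := fun _ => False)
    (by simp) 34 0 _ _ hc0 (by omega) (fun j hj hjc => ⟨(hpath j hjc).1, (hpath j hjc).2,
      fun h => by have := hf.inj 0 (by omega) j (by omega) (by rw [hf.zero, h]); omega,
      fun hj h => by have := hf.inj c (by omega) j (by omega) (by rw [hfc, h]); omega⟩)
    (fun j hj => by
      rw [or_false] at hj
      have := hf.not_conflict (j := j) (k := 0) (by omega) (by omega) (by omega)
        (hpath (j + 1) (by omega)).1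
      rwa [hf.zero] at this) h1
  obtain ⟨v, hv4, hv, hvis'⟩ := exists_testBit_eq_false hfin
  obtain ⟨j, hj, rfl⟩ := hcover v hv4 hv
  have hj0 : j ≠ 0 := fun h => by simp [h, hf.zero] at hv4
  by_cases hj1 : j = 1
  · subst hj1
    simp [hvis _ ((testBit_bit _ _).2 rfl)] at hvis'
  · simp [htr j (by omega) hj] at hvis'

/-- A tour has no initial stretch that runs in the right half to the bottom of the dividing
segment and, after a detour, runs in the right half from its top to the bottom vertex, covering
the right half. -/
theorem Tour.not_detour {f : ℕ → ℕ} (hf : Tour f) {a b c : ℕ} (hba : b < a) (hac : a < c)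
    (hc : c < 33) (hfa : f a = 0) (hfb : f b = 1) (hfc : f c = 3)
    (hpath : ∀ j, j ≤ b ∨ a ≤ j ∧ j ≤ c → f j < 18)
    (hcover : ∀ v, 4 ≤ v → v < 18 → ∃ j, (j ≤ b ∨ a ≤ j ∧ j ≤ c) ∧ f j = v) : False := by
  have h := refuteDetour_eq_true
  have h02 : ∀ j, j ≠ 0 → j ≤ c → f j ≠ 2 := fun j hj hjc h => by
    have := hf.inj 0 (by omega) j (by omega) (by rw [hf.zero, h])
    omega
  have hb0 : 0 < b := Nat.pos_of_ne_zero fun h => by simp [h, hf.zero] at hfb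
  have hne0 : ∀ j, j ≠ a → j ≤ c → f j ≠ 0 := fun j hj hjc h =>
    hj (hf.inj j (by omega) a (by omega) (h.trans hfa.symm))
  have hne1 : ∀ j, j ≠ b → j ≤ c → f j ≠ 1 := fun j hj hjc h =>
    hj (hf.inj j (by omega) b (by omega) (h.trans hfb.symm))
  have hne3 : ∀ j, j < c → f j ≠ 3 := fun j hj h =>
    hj.ne (hf.inj j (by omega) c (by omega) (h.trans hfc.symm))
  have hmem : f 1 ∈ nbrs 2 := by
    have := hf.sees 0 (by omega)
    rw [hf.zero] at this
    exact mem_nbrs.2 ⟨hpath 1 (by omega), (h02 1 (by omega) (by omega)).symm, this⟩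
  have h1 := (allRec_iff _ _).1 h _ hmem
  rw [Bool.or_eq_true, Nat.beq_eq, or_iff_right (hne0 1 (by omega) (by omega))] at h1
  nth_rewrite 1 [← hf.zero] at h1
  obtain ⟨forb, vis, hfin, hforb, hvis, htr⟩ := hf.refute_sound hfb (by omega)
    (E := fun j => a ≤ j ∧ j < c)
    (fun j hj => ⟨by omega, by omega, hpath (j + 1) (by omega)⟩) 34 0 _ _ hb0 (by omega)
    (fun j hj hjb => ⟨hpath j (by omega), hne0 j (by omega) (by omega), h02 j (by omega) (by omega),
      fun _ => hne3 j (by omega)⟩)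
    (fun j hj => by
      have := hf.not_conflict (j := j) (k := 0) (by omega) (by omega) (by omega)
        (hpath (j + 1) (by omega))
      rwa [hf.zero] at this) h1
  have hmem' : f (a + 1) ∈ nbrs 0 := by
    have := hf.sees a (by omega)
    rw [hfa] at this
    exact mem_nbrs.2 ⟨hpath (a + 1) (by omega), (hne0 (a + 1) (by omega) (by omega)).symm, this⟩
  have h2 := (allRec_iff _ _).1 hfin _ hmem'
  have hav := hforb a (by omega)
  rw [hfa] at hav
  rw [Bool.or_eq_true, Bool.or_eq_true, Nat.beq_eq, Bool.not_eq_true', arc_avail.2 hav, or_assoc,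
    or_iff_right (hne1 (a + 1) (by omega) (by omega)), or_iff_right (by simp)] at h2
  nth_rewrite 1 [← hfa] at h2
  obtain ⟨forb', vis', hfin', -, hvis', htr'⟩ := hf.refute_sound hfc (by omega)
    (E := fun _ => False) (by simp) 34 a _ _ hac (by omega)
    (fun j hj hjc => ⟨hpath j (by omega), hne0 j (by omega) (by omega), h02 j (by omega) (by omega),
      hne3 j⟩)
    (fun j hj => by
      rw [or_false] at hj
      have := hf.not_conflict (j := j) (k := a) (by omega) (by omega) (by omega)
        (hpath (j + 1) (by omega))
      rw [hfa] at this
      change Nat.testBit (_ ||| _) _ = false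
      rw [Nat.testBit_or, hforb j (by omega), this]
      rfl) h2
  have hor : ∀ x, vis.testBit x = true ∨ f (a + 1) = x → vis'.testBit x = true := by
    intro x hx
    refine hvis' x ?_
    change Nat.testBit (_ ||| _) _ = true
    rw [Nat.testBit_or, Bool.or_eq_true, testBit_bit]
    exact hx
  obtain ⟨v, hv4, hv, hv'⟩ := exists_testBit_eq_false hfin'
  obtain ⟨j, hj, rfl⟩ := hcover v hv4 hv
  have hj0 : j ≠ 0 := fun h => by simp [h, hf.zero] at hv4
  have hja : j ≠ a := fun h => by simp [h, hfa] at hv4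
  rw [← Bool.not_eq_true] at hv'
  refine hv' ?_
  rcases hj with hj | hj
  · refine hor _ (Or.inl ?_)
    by_cases hj1 : j = 1
    · subst hj1
      exact hvis _ ((testBit_bit _ _).2 rfl)
    · exact htr j (by omega) hj
  · by_cases hj1 : j = a + 1
    · exact hor _ (Or.inr (by rw [hj1]))
    · exact htr' j (by omega) hj.2

/-- Twice the signed area of the triangle `abc`. -/
def det (a b c : ℕ) : ℤ :=
  ((px b : ℤ) - px a) * ((py c : ℤ) - py a) - ((py b : ℤ) - py a) * ((px c : ℤ) - px a)

theorem pos_iff {a b c : ℕ} : pos a b c = true ↔ 0 < det a b c := by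
  rw [pos, Nat.blt_eq, det]
  change px b * py a + (px c * py b + px a * py c) < px a * py b + (px b * py c + px c * py a) ↔ _
  zify
  constructor <;> intro h <;> linarith

theorem pos_rotate (a b c : ℕ) : pos b c a = pos a b c := by
  rw [Bool.eq_iff_iff, pos_iff, pos_iff, det, det]
  constructor <;> intro h <;> linarith

theorem cr_swap_left (a b c d : ℕ) : cr b a c d = cr a b c d := by
  have h : ∀ p q r s t u v w : Bool, (((p && q) || (r && s)) && ((t && u) || (v && w))) =
    (((r && s) || (p && q)) && ((v && w) || (t && u))) := by decide
  rw [cr, cr, h, Bool.and_comm (pos d c b), Bool.and_comm (pos d c a)]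

theorem cr_swap_right (a b c d : ℕ) : cr a b d c = cr a b c d := by
  have h : ∀ p q r s t u v w : Bool, (((p && q) || (r && s)) && ((t && u) || (v && w))) =
    (((s && r) || (q && p)) && ((v && w) || (t && u))) := by decide
  rw [cr, cr, h]

theorem sees_iff {a b : ℕ} :
    sees a b = true ↔ ∀ s ∈ segs, cr a b s.1 s.2 = false := by
  simp [sees, allRec_iff]

theorem sees_symm (a b : ℕ) : sees b a = sees a b := by
  rw [Bool.eq_iff_iff, sees_iff, sees_iff]
  simp only [cr_swap_left a b]

/-- The reflection in the dividing segment. -/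
def mirror (v : ℕ) : ℕ := if v < 2 then v else if v < 18 then v + 16 else if v < 34 then v - 16 else v

theorem mirror_lt {v : ℕ} (hv : v < 34) : mirror v < 34 := by
  unfold mirror
  split_ifs <;> omega

theorem mirror_mirror {v : ℕ} : mirror (mirror v) = v := by
  unfold mirror
  split_ifs <;> omega

theorem px_mirror {v : ℕ} (hv : v < 34) : (px (mirror v) : ℤ) = 100 - px v := by
  decide +revert

theorem py_mirror {v : ℕ} (hv : v < 34) : py (mirror v) = py v := by
  decide +revert

theorem partner_mirror {v : ℕ} (hv : v < 34) : partner (mirror v) = mirror (partner v) := by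
  decide +revert

theorem partner_lt {v : ℕ} (hv : v < 34) : partner v < 34 := by
  decide +revert

theorem segs_mirror : ∀ s ∈ segs, s.1 < 34 ∧ s.2 < 34 ∧
    ((mirror s.1, mirror s.2) ∈ segs ∨ (mirror s.2, mirror s.1) ∈ segs) := by
  decide

theorem pos_mirror {a b c : ℕ} (ha : a < 34) (hb : b < 34) (hc : c < 34) :
    pos (mirror a) (mirror b) (mirror c) = pos b a c := by
  rw [Bool.eq_iff_iff, pos_iff, pos_iff, det, det, px_mirror ha, px_mirror hb, px_mirror hc,
    py_mirror ha, py_mirror hb, py_mirror hc]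
  constructor <;> intro h <;> linarith

theorem cr_mirror {a b c d : ℕ} (ha : a < 34) (hb : b < 34) (hc : c < 34) (hd : d < 34) :
    cr (mirror a) (mirror b) (mirror c) (mirror d) = cr a b c d := by
  have h : ∀ p q r s t u v w : Bool, (((p && q) || (r && s)) && ((t && u) || (v && w))) =
    (((r && s) || (p && q)) && ((v && w) || (t && u))) := by decide
  simp only [cr, pos_mirror, ha, hb, hc, hd]
  rw [h]

theorem sees_mirror {a b : ℕ} (ha : a < 34) (hb : b < 34) :
    sees (mirror a) (mirror b) = sees a b := by
  have key : ∀ a < 34, ∀ b < 34, sees a b = true → sees (mirror a) (mirror b) = true := by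
    intro a ha b hb h
    rw [sees_iff] at h ⊢
    intro s hs
    obtain ⟨h1, h2, h' | h'⟩ := segs_mirror s hs
    · have := cr_mirror ha hb (mirror_lt h1) (mirror_lt h2)
      rw [mirror_mirror, mirror_mirror] at this
      rw [this, h _ h']
    · have := cr_mirror ha hb (mirror_lt h1) (mirror_lt h2)
      rw [mirror_mirror, mirror_mirror] at this
      rw [this, cr_swap_right, h _ h']
  rw [Bool.eq_iff_iff]
  refine ⟨fun h => ?_, key a ha b hb⟩
  have := key _ (mirror_lt ha) _ (mirror_lt hb) h
  rwa [mirror_mirror, mirror_mirror] at this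

theorem coneBad_mirror {u v w : ℕ} (hu : u < 34) (hv : v < 34) (hw : w < 34) :
    coneBad (mirror u) (mirror v) (mirror w) = coneBad w v u := by
  have hinj : ∀ x y, Nat.beq (mirror x) (mirror y) = Nat.beq x y := fun x y => by
    rw [Bool.eq_iff_iff, Nat.beq_eq, Nat.beq_eq]
    exact ⟨fun h => by rw [← mirror_mirror (v := x), h, mirror_mirror], fun h => by rw [h]⟩
  have ht := partner_lt hv
  simp only [coneBad, partner_mirror hv, hinj, pos_mirror, hu, hv, hw, ht]
  rw [← pos_rotate w v u]
  simp only [Bool.and_comm, Bool.or_comm]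

theorem Tour.reflect {f : ℕ → ℕ} (hf : Tour f) : Tour fun i => mirror (f (33 - i)) where
  lt i hi := mirror_lt (hf.lt _ (by omega))
  inj i hi j hj h := by
    have h' := congrArg mirror h
    simp only [mirror_mirror] at h'
    have := hf.inj _ (by omega) _ (by omega) h'
    omega
  zero := by simp [hf.last, mirror]
  last := by simp [hf.zero, mirror]
  sees i hi := by
    have h := hf.sees (33 - (i + 1)) (by omega)
    rw [show 33 - (i + 1) + 1 = 33 - i by omega] at h
    rw [sees_mirror (hf.lt _ (by omega)) (hf.lt _ (by omega)), sees_symm, h]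
  cross i hi j hj := by
    have h := hf.cross (33 - (i + 1)) (by omega) (33 - (j + 1)) (by omega)
    rw [show 33 - (i + 1) + 1 = 33 - i by omega, show 33 - (j + 1) + 1 = 33 - j by omega] at h
    rw [cr_mirror (hf.lt _ (by omega)) (hf.lt _ (by omega)) (hf.lt _ (by omega))
      (hf.lt _ (by omega)), cr_swap_left, cr_swap_right, h]
  cone i hi := by
    have h := hf.cone (33 - (i + 2)) (by omega)
    rw [show 33 - (i + 2) + 1 = 33 - (i + 1) by omega,
      show 33 - (i + 2) + 2 = 33 - i by omega] at h
    rw [coneBad_mirror (hf.lt _ (by omega)) (hf.lt _ (by omega)) (hf.lt _ (by omega)), h]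
  base := by
    obtain ⟨i, hi, h⟩ := hf.base
    refine ⟨32 - i, by omega, ?_⟩
    rw [show 33 - (32 - i) = i + 1 by omega, show 33 - (32 - i + 1) = i by omega]
    rcases h with ⟨h, h'⟩ | ⟨h, h'⟩ <;> simp [h, h', mirror]

theorem Tour.surj {f : ℕ → ℕ} (hf : Tour f) {v : ℕ} (hv : v < 34) : ∃ i < 34, f i = v := by
  have h : (Finset.range 34).image f = Finset.range 34 := by
    refine Finset.eq_of_subset_of_card_le (fun x hx => ?_) ?_
    · obtain ⟨i, hi, rfl⟩ := Finset.mem_image.1 hx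
      exact Finset.mem_range.2 (hf.lt i (Finset.mem_range.1 hi))
    · rw [Finset.card_image_of_injOn]
      intro i hi j hj
      exact hf.inj i (by simpa using hi) j (by simpa using hj)
  have := Finset.mem_range.2 hv
  rw [← h] at this
  simpa using this

theorem sees_across : ∀ v < 18, 2 ≤ v → ∀ w < 34, 18 ≤ w → 
    sees v w = (Nat.beq w (v + 16) && Nat.ble v 3) := by
  decide +kernel

theorem coneBad_top : ∀ u < 18, 2 ≤ u → ∀ w < 34, 18 ≤ w → coneBad u 0 w = true := by
  decide +kernel

theorem coneBad_bottom : ∀ u < 34, 18 ≤ u → ∀ w < 18, 2 ≤ w → coneBad u 1 w = true := by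
  decide +kernel

set_option maxHeartbeats 1000000 in
theorem Tour.trichotomy {f : ℕ → ℕ} (hf : Tour f) {a b c : ℕ} (ha : a < 34) (hb : b < 34)
    (hfa : f a = 0) (hfb : f b = 1) (hc : c < 33)
    (hfc : (f c = 3 ∧ f (c + 1) = 19) ∨ (f c = 19 ∧ f (c + 1) = 3)) :
    f c = 3 ∧ ((∀ k < 34, f k < 18 ↔ k ≤ c ∨ k = a ∨ k = b) ∨
      (b < a ∧ a < c ∧ ∀ k < 34, f k < 18 ↔ k ≤ b ∨ a ≤ k ∧ k ≤ c) ∨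
      (c < a ∧ a < b ∧ ∀ k < 34, f k < 18 ↔ k ≤ c ∨ a ≤ k ∧ k ≤ b)) := by
  have hmem : ∀ k < 34, k ≠ a → k ≠ b → 2 ≤ f k := by
    intro k hk hka hkb
    by_contra! h
    rcases Nat.lt_succ_iff_lt_or_eq.1 h with h | h
    · exact hka (hf.inj k hk a ha (by omega))
    · exact hkb (hf.inj k hk b hb (by omega))
  have hstep : ∀ k < 33, k ≠ a → k ≠ b → k + 1 ≠ a → k + 1 ≠ b → k ≠ c →
      (f k < 18 ↔ f (k + 1) < 18) := by
    intro k hk hka hkb hka' hkb' hkc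
    have h0 := hf.inj 0 (by omega) k (by omega)
    have h33 := hf.inj 33 (by omega) (k + 1) (by omega)
    have h0' := hf.inj 0 (by omega) (k + 1) (by omega)
    have h33' := hf.inj 33 (by omega) k (by omega)
    have h1 := hf.inj c (by omega) k (by omega)
    have h2 := hf.inj (c + 1) (by omega) k (by omega)
    have h3 := hf.inj c (by omega) (k + 1) (by omega)
    have h4 := hf.inj (c + 1) (by omega) (k + 1) (by omega)
    have hk2 := hmem k (by omega) hka hkb
    have hk2' := hmem (k + 1) (by omega) hka' hkb'
    rw [hf.zero] at h0 h0'
    rw [hf.last] at h33 h33'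
    have hs := hf.sees k hk
    constructor <;> intro h <;> by_contra! hc'
    · have := sees_across _ h hk2 _ (hf.lt _ (by omega)) hc'
      rw [hs] at this
      rw [eq_comm, Bool.and_eq_true, Nat.beq_eq, Nat.ble_eq] at this
      omega
    · rw [sees_symm] at hs
      have := sees_across _ h hk2' _ (hf.lt _ (by omega)) hc'
      rw [hs] at this
      rw [eq_comm, Bool.and_eq_true, Nat.beq_eq, Nat.ble_eq] at this
      omega
  have hrun : ∀ i j, i ≤ j → j < 34 → (a < i ∨ j < a) → (b < i ∨ j < b) → (c < i ∨ j ≤ c) →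
      (f i < 18 ↔ f j < 18) := by
    intro i j hij
    induction j, hij using Nat.le_induction with
    | base => simp
    | succ j hij ih =>
      intro hj h1 h2 h3
      rw [ih (by omega) (by omega) (by omega) (by omega)]
      exact hstep j (by omega) (by omega) (by omega) (by omega) (by omega) (by omega)
  have h0 := hf.zero
  have h33 := hf.last
  have ha0 : 0 < a := Nat.pos_of_ne_zero fun h => by simp [h, h0] at hfa
  have ha33 : a ≠ 33 := fun h => by simp [h, h33] at hfa
  have hb0 : 0 < b := Nat.pos_of_ne_zero fun h => by simp [h, h0] at hfb
  have hb33 : b ≠ 33 := fun h => by simp [h, h33] at hfb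
  have hca : c ≠ a := fun h => by subst h; omega
  have hca' : c + 1 ≠ a := fun h => by subst h; omega
  have hcb : c ≠ b := fun h => by subst h; omega
  have hcb' : c + 1 ≠ b := fun h => by subst h; omega
  have hab : a ≠ b := fun h => by subst h; omega
  have hcone : a ≠ b + 1 → b ≠ a + 1 → f (a - 1) < 18 → f (a + 1) < 18 := by
    intro h1 h2 h
    by_contra! hc'
    have := hf.cone (a - 1) (by omega)
    rw [show a - 1 + 1 = a by omega, show a - 1 + 2 = a + 1 by omega, hfa,
      coneBad_top _ h (hmem _ (by omega) (by omega) (by omega)) _ (hf.lt _ (by omega)) hc'] at this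
    simp at this
  have hcone' : a ≠ b + 1 → b ≠ a + 1 → f (b + 1) < 18 → f (b - 1) < 18 := by
    intro h1 h2 h
    by_contra! hc'
    have := hf.cone (b - 1) (by omega)
    rw [show b - 1 + 1 = b by omega, show b - 1 + 2 = b + 1 by omega, hfb,
      coneBad_bottom _ (hf.lt _ (by omega)) hc' _ h (hmem _ (by omega) (by omega) (by omega))] at this
    simp at this
  have hl : ∀ k, k < a → k < b → k ≤ c → f k < 18 := fun k h1 h2 h3 => by
    have := hrun 0 k (by omega) (by omega) (by omega) (by omega) (by omega)
    omega
  have hr : ∀ k < 34, a < k → b < k → c < k → 18 ≤ f k := fun k h0 h1 h2 h3 => by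
    have := hrun k 33 (by omega) (by omega) (by omega) (by omega) (by omega)
    omega
  rcases lt_or_gt_of_ne hab with hab | hab <;> rcases lt_or_gt_of_ne hca with hca | hca <;>
    rcases lt_or_gt_of_ne hcb with hcb | hcb
  · have h1 := hl c (by omega) (by omega) (by omega)
    have h2 := hr 33 (by omega) (by omega) (by omega) (by omega)
    refine ⟨by omega, ?_⟩
    by_cases hm : a + 1 < b ∧ f (a + 1) < 18
    · right; right
      refine ⟨hca, hab, fun k hk => ?_⟩
      have e0 := hl k
      have e1 := hrun (c + 1) k
      have e2 := hrun (a + 1) k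
      have e3 := hr k hk
      have e4 : k = a ∨ k = b → f k < 18 := by rintro (rfl | rfl) <;> omega
      omega
    · left
      intro k hk
      have e0 := hl k
      have e1 := hrun (c + 1) k
      have e2 := hrun (a + 1) k
      have e3 := hr k hk
      have e4 : k = a ∨ k = b → f k < 18 := by rintro (rfl | rfl) <;> omega
      omega
  · omega
  · have h1 := hl (a - 1) (by omega) (by omega) (by omega)
    have h2 := hrun (a + 1) c (by omega) (by omega) (by omega) (by omega) (by omega)
    refine ⟨by omega, Or.inl fun k hk => ?_⟩
    have e1 := hl k
    have e2 := hrun (a + 1) k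
    have e3 := hrun (c + 1) k
    have e4 := hr k hk
    have e5 : k = a ∨ k = b → f k < 18 := by rintro (rfl | rfl) <;> omega
    omega
  · have h1 := hl (a - 1) (by omega) (by omega) (by omega)
    have h2 := hr (c + 1) (by omega) (by omega) (by omega) (by omega)
    refine ⟨by omega, Or.inl fun k hk => ?_⟩
    have e1 := hl k
    have e2 := hrun (a + 1) k
    have e3 := hrun k c
    have e4 := hr k hk
    have e5 : k = a ∨ k = b → f k < 18 := by rintro (rfl | rfl) <;> omega
    omega
  · have h1 := hl c (by omega) (by omega) (by omega)
    have h2 := hr (a + 1) (by omega) (by omega) (by omega) (by omega)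
    have h3 := hrun (c + 1) (b - 1) (by omega) (by omega) (by omega) (by omega) (by omega)
    refine ⟨by omega, Or.inl fun k hk => ?_⟩
    have e1 := hl k
    have e2 := hrun (c + 1) k
    have e3 := hrun (b + 1) k
    have e4 := hr k hk
    have e5 : k = a ∨ k = b → f k < 18 := by rintro (rfl | rfl) <;> omega
    omega
  · have h1 := hl (b - 1) (by omega) (by omega) (by omega)
    have h2 := hr (a + 1) (by omega) (by omega) (by omega) (by omega)
    have h3 := hrun (b + 1) c (by omega) (by omega) (by omega) (by omega) (by omega)
    have h4 := hrun (c + 1) (a - 1) (by omega) (by omega) (by omega) (by omega) (by omega)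
    refine ⟨by omega, Or.inl fun k hk => ?_⟩
    have e1 := hl k
    have e2 := hrun (b + 1) k
    have e3 := hrun (c + 1) k
    have e4 := hr k hk
    have e5 : k = a ∨ k = b → f k < 18 := by rintro (rfl | rfl) <;> omega
    omega
  · omega
  · have h1 := hl (b - 1) (by omega) (by omega) (by omega)
    have h2 := hr (c + 1) (by omega) (by omega) (by omega) (by omega)
    have h3 := hrun (a + 1) c (by omega) (by omega) (by omega) (by omega) (by omega)
    refine ⟨by omega, ?_⟩
    by_cases hm : b + 1 < a ∧ 18 ≤ f (b + 1)
    · right; left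
      refine ⟨hab, hca, fun k hk => ?_⟩
      have e0 := hl k
      have e1 := hrun (b + 1) k
      have e2 := hrun (a + 1) k
      have e3 := hr k hk
      have e4 : k = a ∨ k = b → f k < 18 := by rintro (rfl | rfl) <;> omega
      omega
    · left
      intro k hk
      have e0 := hl k
      have e1 := hrun (b + 1) k
      have e2 := hrun (a + 1) k
      have e3 := hr k hk
      have e4 : k = a ∨ k = b → f k < 18 := by rintro (rfl | rfl) <;> omega
      omega

theorem Tour.false {f : ℕ → ℕ} (hf : Tour f) : False := by
  obtain ⟨a, ha, hfa⟩ := hf.surj (v := 0) (by omega)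
  obtain ⟨b, hb, hfb⟩ := hf.surj (v := 1) (by omega)
  obtain ⟨c, hc, hfc⟩ := hf.base
  obtain ⟨hc3, h⟩ := hf.trichotomy ha hb hfa hfb hc hfc
  have hc19 : f (c + 1) = 19 := by omega
  have hm0 : mirror (f (33 - (33 - a))) = 0 := by
    rw [show 33 - (33 - a) = a by omega, hfa]; rfl
  have hm1 : mirror (f (33 - (33 - b))) = 1 := by
    rw [show 33 - (33 - b) = b by omega, hfb]; rfl
  have hm3 : mirror (f (33 - (32 - c))) = 3 := by
    rw [show 33 - (32 - c) = c + 1 by omega, hc19]; rfl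
  have hside : ∀ v < 34, v ≠ 0 → v ≠ 1 → (mirror v < 18 ↔ ¬ v < 18) := by
    intro v hv h0 h1
    unfold mirror
    split_ifs <;> omega
  have hne : ∀ k < 34, k ≠ a → k ≠ b → f k ≠ 0 ∧ f k ≠ 1 := by
    intro k hk hka hkb
    exact ⟨fun h => hka (hf.inj k hk a ha (h.trans hfa.symm)),
      fun h => hkb (hf.inj k hk b hb (h.trans hfb.symm))⟩
  have hca : c ≠ a := fun h => by subst h; omega
  have hca' : c + 1 ≠ a := fun h => by subst h; omega
  have hcb : c ≠ b := fun h => by subst h; omega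
  have hcb' : c + 1 ≠ b := fun h => by subst h; omega
  have hlt : ∀ k < 34, k ≠ a → k ≠ b → (mirror (f k) < 18 ↔ ¬ f k < 18) := fun k hk h1 h2 =>
    hside _ (hf.lt k hk) (hne k hk h1 h2).1 (hne k hk h1 h2).2
  have hlt' : ∀ k < 34, k = a ∨ k = b → mirror (f k) < 18 := by
    rintro k hk (rfl | rfl)
    · rw [hfa]; decide
    · rw [hfb]; decide
  rcases h with h | ⟨h1, h2, h⟩ | ⟨h1, h2, h⟩
  · rcases lt_or_gt_of_ne hca with hca | hca
    · refine hf.not_direct hc hc3 (fun j hj => ⟨(h j (by omega)).2 (Or.inl hj), ?_⟩) fun v hv4 hv => ?_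
      · by_cases hjb : j = b
        · simp [hjb, hfb]
        · exact (hne j (by omega) (by omega) hjb).1
      · obtain ⟨j, hj, rfl⟩ := hf.surj (v := v) (by omega)
        refine ⟨j, ?_, rfl⟩
        rcases (h j hj).1 hv with h | rfl | rfl <;> omega
    · refine hf.reflect.not_direct (c := 32 - c) (by omega) hm3 (fun j hj => ?_) fun v hv4 hv => ?_
      · by_cases hjb : 33 - j = b
        · simp [hjb, hfb, mirror]
        · have e1 := hlt (33 - j) (by omega) (by omega) hjb
          have e2 := h (33 - j) (by omega)
          refine ⟨by omega, fun h0 => ?_⟩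
          have := hf.reflect.inj j (by omega) (33 - a) (by omega) (h0.trans hm0.symm)
          omega
      · obtain ⟨j, hj, rfl⟩ := hf.reflect.surj (v := v) (by omega)
        refine ⟨j, ?_, rfl⟩
        have e1 := hlt (33 - j) (by omega)
        have e2 := h (33 - j) (by omega)
        have e3 : 33 - j ≠ a := fun h => by simp [h, hfa, mirror] at hv4
        have e4 : 33 - j ≠ b := fun h => by simp [h, hfb, mirror] at hv4
        omega
  · refine hf.not_detour h1 h2 hc hfa hfb hc3 (fun j hj => (h j (by omega)).2 hj) fun v hv4 hv => ?_
    obtain ⟨j, hj, rfl⟩ := hf.surj (v := v) (by omega)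
    exact ⟨j, (h j hj).1 hv, rfl⟩
  · refine hf.reflect.not_detour (a := 33 - a) (b := 33 - b) (c := 32 - c) (by omega) (by omega)
      (by omega) hm0 hm1 hm3 (fun j hj => ?_) fun v hv4 hv => ?_
    · have e1 := hlt (33 - j) (by omega)
      have e2 := h (33 - j) (by omega)
      have e3 := hlt' (33 - j) (by omega)
      omega
    · obtain ⟨j, hj, rfl⟩ := hf.reflect.surj (v := v) (by omega)
      refine ⟨j, ?_, rfl⟩
      have e1 := hlt (33 - j) (by omega)
      have e2 := h (33 - j) (by omega)
      omega

end Config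

open Filter Topology

/-- The cross product of two plane vectors. -/
def wedge (u w : Pt) : ℝ := u.1 * w.2 - u.2 * w.1

/-- `D` points into the sector on the left of the turn from direction `u` to direction `w`. -/
def LeftSector (u w D : Pt) : Prop :=
  0 < wedge u D ∧ 0 < wedge w D ∨ wedge u w ≤ 0 ∧ (0 < wedge u D ∨ 0 < wedge w D)

namespace SimplePolygon

variable (P : SimplePolygon)

instance : NeZero P.n := ⟨by have := P.three_le; omega⟩

/-- The direction vector of the `i`th edge. -/
def edge (i : ZMod P.n) : Pt := P.verts (i + 1) - P.verts i

theorem ne_add_one (i : ZMod P.n) : i ≠ i + 1 := by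
  have : Fact (1 < P.n) := ⟨by have := P.three_le; omega⟩
  simp

theorem edge_ne_zero (i : ZMod P.n) : P.edge i ≠ 0 := by
  rw [edge, sub_ne_zero]
  exact fun h => P.ne_add_one i (P.inj h).symm

theorem exists_left (i : ZMod P.n) :
    ∃ d, 0 < wedge (P.edge i) d ∧ 0 < wedge (P.edge (i + 1)) d := by
  have hu := P.edge_ne_zero i
  have hw := P.edge_ne_zero (i + 1)
  have hadj := P.edges_adj i
  have hu' : P.verts i = P.verts (i + 1) - P.edge i := by simp [edge]
  have hw' : P.verts (i + 1 + 1) = P.verts (i + 1) + P.edge (i + 1) := by simp [edge]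
  rw [hu', hw'] at hadj
  generalize P.edge i = u at *
  generalize P.edge (i + 1) = w at *
  generalize P.verts (i + 1) = v at *
  by_cases hc : wedge u w = 0
  · have hpos : 0 < u.1 ^ 2 + u.2 ^ 2 := by
      by_contra! h
      have h1 : u.1 = 0 := by nlinarith [sq_nonneg u.1, sq_nonneg u.2]
      have h2 : u.2 = 0 := by nlinarith [sq_nonneg u.1, sq_nonneg u.2]
      exact hu (Prod.ext h1 h2)
    obtain ⟨l, hl⟩ : ∃ l, l = (u.1 * w.1 + u.2 * w.2) / (u.1 ^ 2 + u.2 ^ 2) := ⟨_, rfl⟩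
    have hwl : w = l • u := by
      rw [wedge] at hc
      ext
      · simp only [Prod.smul_fst, smul_eq_mul, hl]
        field_simp
        linear_combination -u.2 * hc
      · simp only [Prod.smul_snd, smul_eq_mul, hl]
        field_simp
        linear_combination u.1 * hc
    have hl0 : 0 < l := by
      by_contra! hneg
      have hl1 : 0 < 1 - l := by linarith
      obtain ⟨m, hm⟩ : ∃ m, m = 1 / (1 - l) := ⟨_, rfl⟩
      have hm0 : 0 < m := by rw [hm]; positivity
      have hm1 : m * (1 - l) = 1 := by rw [hm]; field_simp
      have hmem : v + m • w ∈ segment ℝ (v - u) v ∩ segment ℝ v (v + w) := by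
        constructor
        · refine ⟨m * -l, m, by nlinarith, hm0.le, by linarith, ?_⟩
          rw [hwl]
          linear_combination (norm := module) hm1 • v
        · exact ⟨1 - m, m, by nlinarith, hm0.le, by ring, by module⟩
      rw [hadj, mem_singleton_iff, add_eq_left, smul_eq_zero] at hmem
      rcases hmem with h | h
      · exact hm0.ne' h
      · exact hw h
    refine ⟨(-u.2, u.1), ?_, ?_⟩
    · simp only [wedge]
      nlinarith
    · rw [hwl]
      simp only [wedge, Prod.smul_fst, Prod.smul_snd, smul_eq_mul]
      nlinarith [mul_pos hl0 hpos]
  · refine ⟨wedge u w • (w - u), ?_, ?_⟩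
    all_goals
      have := sq_pos_of_ne_zero hc
      simp only [wedge, Prod.smul_fst, Prod.smul_snd, smul_eq_mul, Prod.fst_sub, Prod.snd_sub] at *
      nlinarith

theorem eventually_notMem_segment {a b c d e f : Pt}
    (h : Disjoint (segment ℝ a b) (segment ℝ c d)) :
    ∀ᶠ s : ℝ in 𝓝[>] 0, Disjoint (segment ℝ (a + s • e) (b + s • f)) (segment ℝ c d) := by
  have hclosed : IsClosed (segment ℝ c d) := by
    rw [segment_eq_image]
    exact (isCompact_Icc.image (by fun_prop)).isClosed
  have key : ∀ᶠ s : ℝ in 𝓝 0, ∀ t ∈ Icc (0 : ℝ) 1,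
      (1 - t) • (a + s • e) + t • (b + s • f) ∈ (segment ℝ c d)ᶜ := by
    refine isCompact_Icc.eventually_forall_of_forall_eventually fun t ht => ?_
    have hcont : Continuous fun z : ℝ × ℝ =>
      (1 - z.2) • (a + z.1 • e) + z.2 • (b + z.1 • f) := by fun_prop
    refine hcont.continuousAt.eventually_mem (hclosed.isOpen_compl.mem_nhds ?_)
    refine disjoint_left.1 h ?_
    rw [segment_eq_image]
    exact ⟨t, ht, by simp⟩
  filter_upwards [key.filter_mono nhdsWithin_le_nhds] with s hs
  rw [segment_eq_image, disjoint_left]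
  rintro _ ⟨t, ht, rfl⟩
  exact hs t ht

theorem disjoint_segment_shift_self {a b d e : Pt} {s : ℝ} (hs : 0 < s)
    (hd : 0 < wedge (b - a) d) (he : 0 < wedge (b - a) e) :
    Disjoint (segment ℝ (a + s • d) (b + s • e)) (segment ℝ a b) := by
  rw [segment_eq_image, segment_eq_image, disjoint_left]
  rintro _ ⟨t, ⟨ht0, ht1⟩, rfl⟩ ⟨r, -, h⟩
  have h1 := congrArg Prod.fst h
  have h2 := congrArg Prod.snd h
  simp only [wedge, Prod.fst_sub, Prod.snd_sub, Prod.fst_add, Prod.snd_add, Prod.smul_fst,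
    Prod.smul_snd, smul_eq_mul] at *
  have key : (1 - t) * ((b.1 - a.1) * d.2 - (b.2 - a.2) * d.1) +
      t * ((b.1 - a.1) * e.2 - (b.2 - a.2) * e.1) = 0 := by
    refine (mul_eq_zero.1 (?_ : s * _ = 0)).resolve_left hs.ne'
    linear_combination (b.2 - a.2) * h1 - (b.1 - a.1) * h2
  rcases ht0.eq_or_lt with rfl | ht
  · linarith
  · nlinarith [mul_pos ht he, mul_nonneg (sub_nonneg.2 ht1) hd.le]

theorem eventually_pos_add_mul {x : ℝ} (hx : 0 < x) (y : ℝ) : ∀ᶠ s : ℝ in 𝓝[>] 0, 0 < x + s * y := by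
  have h : ContinuousAt (fun s : ℝ => x + s * y) 0 := by fun_prop
  exact (h.eventually_const_lt (by simpa using hx)).filter_mono nhdsWithin_le_nhds

theorem eventually_disjoint_segment_next {a b c d e : Pt} (hd : 0 < wedge (b - a) d)
    (he : 0 < wedge (b - a) e) (he' : 0 < wedge (c - b) e) :
    ∀ᶠ s : ℝ in 𝓝[>] 0, Disjoint (segment ℝ (a + s • d) (b + s • e)) (segment ℝ b c) := by
  have hev : ∀ᶠ s : ℝ in 𝓝[>] 0, 0 < wedge (b - a) (c - b) →
      0 < wedge (b - a) (c - b) + s * wedge (c - b) d := by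
    by_cases hc : 0 < wedge (b - a) (c - b)
    · exact (eventually_pos_add_mul hc _).mono fun _ h _ => h
    · exact Eventually.of_forall fun _ h => absurd h hc
  filter_upwards [hev, self_mem_nhdsWithin] with s hs hs0
  rw [mem_Ioi] at hs0
  rw [segment_eq_image, segment_eq_image, disjoint_left]
  rintro _ ⟨t, ⟨ht0, ht1⟩, rfl⟩ ⟨r, ⟨hr0, hr1⟩, h⟩
  have h1 := congrArg Prod.fst h
  have h2 := congrArg Prod.snd h
  simp only [wedge, Prod.fst_sub, Prod.snd_sub, Prod.fst_add, Prod.snd_add, Prod.smul_fst,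
    Prod.smul_snd, smul_eq_mul] at *
  have key1 : r * ((b.1 - a.1) * (c.2 - b.2) - (b.2 - a.2) * (c.1 - b.1)) =
      s * ((1 - t) * ((b.1 - a.1) * d.2 - (b.2 - a.2) * d.1) +
        t * ((b.1 - a.1) * e.2 - (b.2 - a.2) * e.1)) := by
    linear_combination (b.1 - a.1) * h2 - (b.2 - a.2) * h1
  have key2 : (1 - t) * ((b.1 - a.1) * (c.2 - b.2) - (b.2 - a.2) * (c.1 - b.1) +
      s * ((c.1 - b.1) * d.2 - (c.2 - b.2) * d.1)) +
      t * (s * ((c.1 - b.1) * e.2 - (c.2 - b.2) * e.1)) = 0 := by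
    linear_combination (c.2 - b.2) * h1 - (c.1 - b.1) * h2
  have hpos : 0 < (1 - t) * ((b.1 - a.1) * d.2 - (b.2 - a.2) * d.1) +
        t * ((b.1 - a.1) * e.2 - (b.2 - a.2) * e.1) := by
    rcases ht0.eq_or_lt with rfl | ht
    · linarith
    · nlinarith [mul_pos ht he, mul_nonneg (sub_nonneg.2 ht1) hd.le]
  have hc := hs (pos_of_mul_pos_right (key1 ▸ mul_pos hs0 hpos) hr0)
  rcases ht0.eq_or_lt with rfl | ht
  · linarith
  · nlinarith [mul_pos ht (mul_pos hs0 he'), mul_nonneg (sub_nonneg.2 ht1) hc.le]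

theorem eventually_disjoint_segment_prev {a b c d e : Pt} (hd : 0 < wedge (b - a) d)
    (hd' : 0 < wedge (c - b) d) (he : 0 < wedge (c - b) e) :
    ∀ᶠ s : ℝ in 𝓝[>] 0, Disjoint (segment ℝ (b + s • d) (c + s • e)) (segment ℝ a b) := by
  have hev : ∀ᶠ s : ℝ in 𝓝[>] 0, 0 < wedge (b - a) (c - b) →
      0 < wedge (b - a) (c - b) + s * wedge (b - a) e := by
    by_cases hc : 0 < wedge (b - a) (c - b)
    · exact (eventually_pos_add_mul hc _).mono fun _ h _ => h
    · exact Eventually.of_forall fun _ h => absurd h hc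
  filter_upwards [hev, self_mem_nhdsWithin] with s hs hs0
  rw [mem_Ioi] at hs0
  rw [segment_eq_image, segment_eq_image, disjoint_left]
  rintro _ ⟨t, ⟨ht0, ht1⟩, rfl⟩ ⟨r, ⟨hr0, hr1⟩, h⟩
  have h1 := congrArg Prod.fst h
  have h2 := congrArg Prod.snd h
  simp only [wedge, Prod.fst_sub, Prod.snd_sub, Prod.fst_add, Prod.snd_add, Prod.smul_fst,
    Prod.smul_snd, smul_eq_mul] at *
  have key1 : (1 - r) * ((b.1 - a.1) * (c.2 - b.2) - (b.2 - a.2) * (c.1 - b.1)) =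
      s * ((1 - t) * ((c.1 - b.1) * d.2 - (c.2 - b.2) * d.1) +
        t * ((c.1 - b.1) * e.2 - (c.2 - b.2) * e.1)) := by
    linear_combination (c.1 - b.1) * h2 - (c.2 - b.2) * h1
  have key2 : t * ((b.1 - a.1) * (c.2 - b.2) - (b.2 - a.2) * (c.1 - b.1) +
      s * ((b.1 - a.1) * e.2 - (b.2 - a.2) * e.1)) +
      (1 - t) * (s * ((b.1 - a.1) * d.2 - (b.2 - a.2) * d.1)) = 0 := by
    linear_combination (b.2 - a.2) * h1 - (b.1 - a.1) * h2
  have hpos : 0 < (1 - t) * ((c.1 - b.1) * d.2 - (c.2 - b.2) * d.1) +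
        t * ((c.1 - b.1) * e.2 - (c.2 - b.2) * e.1) := by
    rcases ht0.eq_or_lt with rfl | ht
    · linarith
    · nlinarith [mul_pos ht he, mul_nonneg (sub_nonneg.2 ht1) hd'.le]
  have hc := hs (pos_of_mul_pos_right (key1 ▸ mul_pos hs0 hpos) (sub_nonneg.2 hr1))
  rcases ht0.eq_or_lt with rfl | ht
  · have := mul_pos hs0 hd
    linarith
  · nlinarith [mul_pos ht hc, mul_nonneg (sub_nonneg.2 ht1) (mul_pos hs0 hd).le]

theorem eventually_disjoint_boundary_corridor (i : ZMod P.n) {d e : Pt}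
    (h0 : 0 < wedge (P.edge (i - 1)) d) (h1 : 0 < wedge (P.edge i) d)
    (h2 : 0 < wedge (P.edge i) e) (h3 : 0 < wedge (P.edge (i + 1)) e) :
    ∀ᶠ s : ℝ in 𝓝[>] 0,
      Disjoint (segment ℝ (P.verts i + s • d) (P.verts (i + 1) + s • e)) P.boundary := by
  simp only [boundary, disjoint_iUnion_right]
  refine eventually_all.2 fun j => ?_
  by_cases hji : j = i
  · subst hji
    filter_upwards [self_mem_nhdsWithin] with s hs
    exact disjoint_segment_shift_self hs h1 h2
  by_cases hji1 : j = i + 1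
  · subst hji1
    exact eventually_disjoint_segment_next h1 h2 h3
  by_cases hij1 : i = j + 1
  · subst hij1
    rw [add_sub_cancel_right] at h0
    exact eventually_disjoint_segment_prev h0 h1 h2
  · exact eventually_notMem_segment (disjoint_iff_inter_eq_empty.2 (P.edges_nonadj i j hji hji1 hij1))

theorem vert_mem_segment {i j : ZMod P.n}
    (h : P.verts i ∈ segment ℝ (P.verts j) (P.verts (j + 1))) : i = j ∨ i = j + 1 := by
  by_contra! hne
  have hi : P.verts i ∈ segment ℝ (P.verts i) (P.verts (i + 1)) := left_mem_segment _ _ _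
  by_cases hji : j = i + 1
  · subst hji
    have := (P.edges_adj i).subset ⟨hi, h⟩
    exact P.ne_add_one i (P.inj this)
  · exact (P.edges_nonadj i j hne.1.symm hji hne.2).subset ⟨hi, h⟩

theorem disjoint_segment_sector {a b c d D : Pt} {s : ℝ} (hs : 0 < s) (hd : 0 < wedge (b - a) d)
    (hd' : 0 < wedge (c - b) d) (hD : LeftSector (b - a) (c - b) D) :
    Disjoint (segment ℝ (b + s • d) (b + s • D)) (segment ℝ a b) ∧
      Disjoint (segment ℝ (b + s • d) (b + s • D)) (segment ℝ b c) := by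
  have hpos : ∀ w : Pt, 0 < wedge w d → 0 < wedge w D → ∀ t ∈ Icc (0 : ℝ) 1,
      0 < s * ((1 - t) * wedge w d + t * wedge w D) := by
    rintro w hw hw' t ⟨ht0, ht1⟩
    refine mul_pos hs ?_
    rcases ht0.eq_or_lt with rfl | ht
    · linarith
    · nlinarith [mul_pos ht hw', mul_nonneg (sub_nonneg.2 ht1) hw.le]
  constructor
  · rw [segment_eq_image, segment_eq_image, disjoint_left]
    rintro _ ⟨t, ht, rfl⟩ ⟨r, ⟨hr0, hr1⟩, h⟩
    have h1 := congrArg Prod.fst h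
    have h2 := congrArg Prod.snd h
    have hu := hpos _ hd
    have hw := hpos _ hd'
    simp only [LeftSector, wedge, Prod.fst_sub, Prod.snd_sub, Prod.fst_add, Prod.snd_add,
      Prod.smul_fst, Prod.smul_snd, smul_eq_mul] at *
    have key1 : s * ((1 - t) * ((b.1 - a.1) * d.2 - (b.2 - a.2) * d.1) +
        t * ((b.1 - a.1) * D.2 - (b.2 - a.2) * D.1)) = 0 := by
      linear_combination (b.2 - a.2) * h1 - (b.1 - a.1) * h2
    have key2 : s * ((1 - t) * ((c.1 - b.1) * d.2 - (c.2 - b.2) * d.1) +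
        t * ((c.1 - b.1) * D.2 - (c.2 - b.2) * D.1)) =
        (1 - r) * ((b.1 - a.1) * (c.2 - b.2) - (b.2 - a.2) * (c.1 - b.1)) := by
      linear_combination (c.2 - b.2) * h1 - (c.1 - b.1) * h2
    rcases hD with ⟨hD, -⟩ | ⟨hc, hD | hD⟩
    · exact (hu hD t ht).ne' key1
    · exact (hu hD t ht).ne' key1
    · nlinarith [hw hD t ht, mul_nonneg (sub_nonneg.2 hr1) (neg_nonneg.2 hc)]
  · rw [segment_eq_image, segment_eq_image, disjoint_left]
    rintro _ ⟨t, ht, rfl⟩ ⟨r, ⟨hr0, hr1⟩, h⟩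
    have h1 := congrArg Prod.fst h
    have h2 := congrArg Prod.snd h
    have hu := hpos _ hd
    have hw := hpos _ hd'
    simp only [LeftSector, wedge, Prod.fst_sub, Prod.snd_sub, Prod.fst_add, Prod.snd_add,
      Prod.smul_fst, Prod.smul_snd, smul_eq_mul] at *
    have key1 : s * ((1 - t) * ((c.1 - b.1) * d.2 - (c.2 - b.2) * d.1) +
        t * ((c.1 - b.1) * D.2 - (c.2 - b.2) * D.1)) = 0 := by
      linear_combination (c.2 - b.2) * h1 - (c.1 - b.1) * h2
    have key2 : s * ((1 - t) * ((b.1 - a.1) * d.2 - (b.2 - a.2) * d.1) +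
        t * ((b.1 - a.1) * D.2 - (b.2 - a.2) * D.1)) =
        r * ((b.1 - a.1) * (c.2 - b.2) - (b.2 - a.2) * (c.1 - b.1)) := by
      linear_combination (b.2 - a.2) * h1 - (b.1 - a.1) * h2
    rcases hD with ⟨-, hD⟩ | ⟨hc, hD | hD⟩
    · exact (hw hD t ht).ne' key1
    · nlinarith [hu hD t ht, mul_nonneg hr0 (neg_nonneg.2 hc)]
    · exact (hw hD t ht).ne' key1

theorem eventually_disjoint_boundary_sector (i : ZMod P.n) {d D : Pt}
    (h0 : 0 < wedge (P.edge (i - 1)) d) (h1 : 0 < wedge (P.edge i) d)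
    (hD : LeftSector (P.edge (i - 1)) (P.edge i) D) :
    ∀ᶠ s : ℝ in 𝓝[>] 0, Disjoint (segment ℝ (P.verts i + s • d) (P.verts i + s • D)) P.boundary := by
  simp only [boundary, disjoint_iUnion_right]
  refine eventually_all.2 fun j => ?_
  have hprev : P.edge (i - 1) = P.verts i - P.verts (i - 1) := by rw [edge, sub_add_cancel]
  rw [hprev] at h0 hD
  by_cases hji : j = i
  · subst hji
    filter_upwards [self_mem_nhdsWithin] with s hs
    exact (disjoint_segment_sector hs h0 h1 hD).2
  by_cases hij : j = i - 1
  · subst hij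
    filter_upwards [self_mem_nhdsWithin] with s hs
    rw [sub_add_cancel]
    exact (disjoint_segment_sector hs h0 h1 hD).1
  refine eventually_notMem_segment ?_
  rw [segment_same, disjoint_singleton_left]
  intro h
  rcases P.vert_mem_segment h with h | h
  · exact hji h.symm
  · exact hij (by rw [h, add_sub_cancel_right])

theorem connectedComponentIn_eq_of_segment {F : Set Pt} {a b : Pt}
    (h : Disjoint (segment ℝ a b) F) :
    connectedComponentIn Fᶜ a = connectedComponentIn Fᶜ b :=
  connectedComponentIn_eq ((convex_segment a b).isPreconnected.subset_connectedComponentIn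
    (left_mem_segment _ _ _) h.subset_compl_right (right_mem_segment _ _ _))

theorem notMem_interiorRegion_of_ray {p e : Pt} (he : e ≠ 0)
    (h : ∀ r : ℝ, 0 ≤ r → p + r • e ∉ P.boundary) : p ∉ P.interiorRegion := by
  rintro ⟨-, hb⟩
  have hpre : IsPreconnected ((fun r : ℝ => p + r • e) '' Ici 0) :=
    isPreconnected_Ici.image _ (by fun_prop)
  have hsub : (fun r : ℝ => p + r • e) '' Ici 0 ⊆ connectedComponentIn P.boundaryᶜ p := by
    refine hpre.subset_connectedComponentIn ⟨0, self_mem_Ici, by simp⟩ ?_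
    rintro _ ⟨r, hr, rfl⟩
    exact h r hr
  obtain ⟨C, hC⟩ := (hb.subset hsub).exists_norm_le
  have hen : 0 < ‖e‖ := norm_pos_iff.2 he
  have hC0 : 0 ≤ C := (norm_nonneg _).trans (hC _ ⟨0, self_mem_Ici, rfl⟩)
  have hr : 0 ≤ (C + ‖p‖ + 1) / ‖e‖ := by positivity
  have h1 := hC _ ⟨_, hr, rfl⟩
  have h2 : ‖((C + ‖p‖ + 1) / ‖e‖) • e‖ = C + ‖p‖ + 1 := by
    rw [norm_smul, Real.norm_of_nonneg hr]
    field_simp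
  have h3 := norm_le_add_norm_add' (((C + ‖p‖ + 1) / ‖e‖) • e) p
  have h4 := norm_sub_le (p + ((C + ‖p‖ + 1) / ‖e‖) • e) p
  rw [add_sub_cancel_left] at h4
  linarith

/-- If the left side of one edge is exterior, no internal diagonal leaves a vertex to the left. -/
theorem not_openSegment_subset_interiorRegion {k : ZMod P.n}
    (hk : ∀ p, 0 < wedge (P.edge k) (p - P.verts k) → p ∉ P.interiorRegion) (i : ZMod P.n)
    {b : Pt} (hb : LeftSector (P.edge (i - 1)) (P.edge i) (b - P.verts i)) :
    ¬ openSegment ℝ (P.verts i) b ⊆ P.interiorRegion := by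
  intro hsub
  choose d' hd1 hd2 using P.exists_left
  obtain ⟨d, hd⟩ : ∃ d : ZMod P.n → Pt, d = fun j => d' (j - 1) := ⟨_, rfl⟩
  have hl : ∀ j, 0 < wedge (P.edge (j - 1)) (d j) := fun j => hd ▸ hd1 (j - 1)
  have hr : ∀ j, 0 < wedge (P.edge j) (d j) := fun j => by
    have := hd2 (j - 1)
    rw [sub_add_cancel] at this
    exact hd ▸ this
  have hl' : ∀ j, 0 < wedge (P.edge j) (d (j + 1)) := fun j => by
    simpa using hl (j + 1)
  have hcor := eventually_all.2 fun j =>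
    P.eventually_disjoint_boundary_corridor j (hl j) (hr j) (hl' j) (hr (j + 1))
  have hsec := P.eventually_disjoint_boundary_sector i (hl i) (hr i) hb
  have hlt : ∀ᶠ s : ℝ in 𝓝[>] 0, s < 1 :=
    (eventually_lt_nhds one_pos).filter_mono nhdsWithin_le_nhds
  obtain ⟨s, ⟨hs, hsec, hs1⟩, hs0⟩ :=
    ((hcor.and (hsec.and hlt)).and self_mem_nhdsWithin).exists
  have hconst : ∀ m : ℕ, connectedComponentIn P.boundaryᶜ (P.verts (k + m) + s • d (k + m)) =
      connectedComponentIn P.boundaryᶜ (P.verts k + s • d k) := by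
    intro m
    induction m with
    | zero => simp
    | succ m ih =>
      rw [← ih, connectedComponentIn_eq_of_segment (hs (k + m))]
      push_cast
      rw [add_assoc]
  have hi : k + ((i - k).val : ZMod P.n) = i := by simp
  have hcomp := hconst (i - k).val
  rw [hi, connectedComponentIn_eq_of_segment hsec] at hcomp
  have hmem : P.verts i + s • (b - P.verts i) ∈ P.interiorRegion := by
    refine hsub ⟨1 - s, s, by linarith, hs0, by ring, by module⟩
  refine hk (P.verts k + s • d k) ?_ ⟨?_, hcomp ▸ hmem.2⟩
  · have := mul_pos hs0 (hr k)
    rw [add_sub_cancel_left]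
    simp only [wedge, Prod.smul_fst, Prod.smul_snd, smul_eq_mul] at *
    linarith
  · exact disjoint_left.1 (hs k) (left_mem_segment _ _ _)

end SimplePolygon

theorem orient_eq_wedge (a b c : Pt) : orient a b c = wedge (b - a) (c - b) := by
  simp only [orient, wedge, Prod.fst_sub, Prod.snd_sub]
  ring

theorem orient_eq_wedge' (a b c : Pt) : orient a b c = wedge (b - a) (c - a) := by
  simp only [orient, wedge, Prod.fst_sub, Prod.snd_sub]

/-- The segments `ab` and `cd` cross properly. -/
def Crosses (a b c d : Pt) : Prop :=
  orient a b c * orient a b d < 0 ∧ orient c d a * orient c d b < 0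

theorem Crosses.exists_mem {a b c d : Pt} (h : Crosses a b c d) :
    ∃ x, x ∈ openSegment ℝ a b ∧ x ∈ openSegment ℝ c d := by
  obtain ⟨h1, h2⟩ := h
  obtain ⟨N, hN⟩ : ∃ N, N = orient a b d - orient a b c := ⟨_, rfl⟩
  have hN' : N = orient c d a - orient c d b := by
    rw [hN]
    simp only [orient]
    ring
  have hN0 : N ≠ 0 := by
    intro h0
    have : orient a b d = orient a b c := by linarith
    rw [this] at h1
    nlinarith [mul_self_nonneg (orient a b c)]
  have pos_of : ∀ x y : ℝ, x * y < 0 → N = x - y → 0 < x / N ∧ 0 < -y / N := by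
    intro x y hxy hxN
    rw [hxN] at hN0 ⊢
    rcases mul_neg_iff.1 hxy with ⟨hx, hy⟩ | ⟨hx, hy⟩
    · have : 0 < x - y := by linarith
      exact ⟨div_pos hx this, div_pos (neg_pos.2 hy) this⟩
    · have : x - y < 0 := by linarith
      exact ⟨div_pos_of_neg_of_neg hx this, div_pos_of_neg_of_neg (neg_neg_of_pos hy) this⟩
  obtain ⟨ht, ht'⟩ := pos_of _ _ h2 hN'
  obtain ⟨hr', hr⟩ := pos_of _ _ (by rwa [mul_comm] at h1) hN
  refine ⟨(-orient c d b / N) • a + (orient c d a / N) • b,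
    ⟨_, _, ht', ht, by field_simp; linarith, rfl⟩,
    ⟨orient a b d / N, -orient a b c / N, hr', hr, by field_simp; linarith, ?_⟩⟩
  ext
  all_goals
    simp only [Prod.fst_add, Prod.snd_add, Prod.smul_fst, Prod.smul_snd, smul_eq_mul]
    field_simp
    simp only [orient]
    ring

namespace SimplePolygon

variable (P : SimplePolygon)

theorem not_crosses_edges (i j : ZMod P.n) :
    ¬ Crosses (P.verts i) (P.verts (i + 1)) (P.verts j) (P.verts (j + 1)) := by
  intro h
  by_cases hji : j = i
  · subst hji
    have := h.1
    simp [orient] at this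
  by_cases hji1 : j = i + 1
  · subst hji1
    have := h.1
    simp [orient, mul_comm] at this
  by_cases hij1 : i = j + 1
  · subst hij1
    have := h.1
    simp [orient] at this
  obtain ⟨x, hx, hx'⟩ := h.exists_mem
  exact (P.edges_nonadj i j hji hji1 hij1).subset
    ⟨openSegment_subset_segment _ _ _ hx, openSegment_subset_segment _ _ _ hx'⟩

theorem not_crosses_of_edge_or_diagonal (i : ZMod P.n) {a b : Pt}
    (h : P.IsEdgeOf a b ∨ P.IsInternalDiagonal a b) :
    ¬ Crosses (P.verts i) (P.verts (i + 1)) a b := by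
  rcases h with ⟨j, ⟨rfl, rfl⟩ | ⟨rfl, rfl⟩⟩ | ⟨-, -, -, -, hsub⟩
  · exact P.not_crosses_edges i j
  · intro h
    refine P.not_crosses_edges i j ⟨by linarith [h.1], ?_⟩
    have := h.2
    simp only [orient] at *
    linarith
  · intro h
    obtain ⟨x, hx, hx'⟩ := h.exists_mem
    exact (hsub hx').1 (mem_iUnion.2 ⟨i, openSegment_subset_segment _ _ _ hx⟩)

/-- The interior of a polygon lies strictly between its lowest and its highest vertices. -/
theorem notMem_interiorRegion_of_le {σ h : ℝ} (hσ : σ ≠ 0) (hv : ∀ i, σ * (P.verts i).2 ≤ h)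
    {p : Pt} (hp : h ≤ σ * p.2) : p ∉ P.interiorRegion := by
  intro hin
  refine P.notMem_interiorRegion_of_ray (e := (0, σ)) (by simp [hσ]) (fun r hr hmem => ?_) hin
  rcases hr.eq_or_lt with rfl | hr
  · rw [zero_smul, add_zero] at hmem
    exact hin.1 hmem
  obtain ⟨i, a, b, ha, hb, hab, hx⟩ := mem_iUnion.1 hmem
  have hx2 := congrArg Prod.snd hx
  simp only [Prod.snd_add, Prod.smul_snd, smul_eq_mul] at hx2
  have hrσ : 0 < r * (σ * σ) := mul_pos hr (mul_self_pos.2 hσ)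
  have h1 := mul_le_mul_of_nonneg_left (hv i) ha
  have h2 := mul_le_mul_of_nonneg_left (hv (i + 1)) hb
  have h3 : a * h + b * h = h := by rw [← add_mul, hab, one_mul]
  have h4 : a * (σ * (P.verts i).2) + b * (σ * (P.verts (i + 1)).2) =
      σ * p.2 + r * (σ * σ) := by linear_combination σ * hx2
  linarith

theorem neg_add_one_add_one {n : ℕ} (i : ZMod n) : -(i + 1) + 1 = -i := by ring

theorem segment_neg (i : ZMod P.n) : segment ℝ (P.verts (-i)) (P.verts (-(i + 1))) =
    segment ℝ (P.verts (-(i + 1))) (P.verts (-(i + 1) + 1)) := by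
  rw [segment_symm, neg_add_one_add_one]

/-- The same polygon, traversed in the opposite direction. -/
def reverse : SimplePolygon where
  n := P.n
  three_le := P.three_le
  verts i := P.verts (-i)
  inj := P.inj.comp neg_injective
  edges_nonadj i j h1 h2 h3 := by
    rw [P.segment_neg, P.segment_neg]
    refine P.edges_nonadj _ _ ?_ ?_ ?_
    · simpa using h1
    · rw [neg_add_one_add_one]
      exact fun h => h3 (neg_injective h.symm)
    · rw [neg_add_one_add_one]
      exact fun h => h2 (neg_injective h.symm)
  edges_adj i := by
    have h := P.edges_adj (-(i + 1 + 1))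
    rw [P.segment_neg, P.segment_neg, inter_comm]
    rwa [neg_add_one_add_one] at h ⊢

theorem reverse_boundary : P.reverse.boundary = P.boundary := by
  refine Subset.antisymm (iUnion_subset fun (i : ZMod P.n) => ?_) (iUnion_subset fun i => ?_)
  · exact (P.segment_neg i).subset.trans (subset_iUnion_of_subset (-(i + 1)) subset_rfl)
  · have h : segment ℝ (P.verts i) (P.verts (i + 1)) =
        segment ℝ (P.verts (-(-(i + 1)))) (P.verts (-(-(i + 1) + 1))) := by
      rw [neg_add_one_add_one, neg_neg, neg_neg, segment_symm]
    exact subset_iUnion_of_subset (ι := ZMod P.n) (-(i + 1)) h.subset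

theorem reverse_isEdgeOf {u v : Pt} : P.reverse.IsEdgeOf u v ↔ P.IsEdgeOf u v := by
  constructor
  · rintro ⟨(i : ZMod P.n), hi⟩
    refine ⟨-(i + 1), ?_⟩
    rw [neg_add_one_add_one]
    exact hi.symm.imp And.symm And.symm
  · rintro ⟨i, hi⟩
    have hi' : (u = P.verts (-(-(i + 1))) ∧ v = P.verts (-(-(i + 1) + 1))) ∨
        (v = P.verts (-(-(i + 1))) ∧ u = P.verts (-(-(i + 1) + 1))) := by
      rw [neg_add_one_add_one, neg_neg, neg_neg]
      exact hi.symm.imp And.symm And.symm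
    exact ⟨(-(i + 1) : ZMod P.n), hi'⟩

theorem range_reverse : range P.reverse.verts = range P.verts :=
  neg_surjective.range_comp P.verts

theorem reverse_circumscribes {S : Finset (Pt × Pt)} (h : Circumscribes P S) :
    Circumscribes P.reverse S := by
  refine ⟨P.range_reverse.trans h.1, fun s hs => ?_⟩
  simpa only [IsInternalDiagonal, IsVertex, interiorRegion, reverse_boundary, range_reverse,
    reverse_isEdgeOf] using h.2 s hs

end SimplePolygon

namespace Config

/-- The endpoint with index `v`. -/
noncomputable def pt (v : ℕ) : Pt := (px v, py v)

theorem orient_pt (a b c : ℕ) : orient (pt a) (pt b) (pt c) = det a b c := by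
  simp [orient, pt, det]

theorem pos_iff_orient {a b c : ℕ} : pos a b c = true ↔ 0 < orient (pt a) (pt b) (pt c) := by
  rw [orient_pt, pos_iff, Int.cast_pos]

theorem orient_swap (a b c : Pt) : orient b a c = -orient a b c := by
  simp only [orient]
  ring

theorem crosses_of_cr {a b c d : ℕ} (h : cr a b c d = true) :
    Crosses (pt a) (pt b) (pt c) (pt d) := by
  simp only [cr, Bool.and_eq_true, Bool.or_eq_true, pos_iff_orient] at h
  rw [orient_swap (pt a) (pt b), orient_swap (pt a) (pt b), orient_swap (pt c) (pt d),
    orient_swap (pt c) (pt d)] at h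
  obtain ⟨h1, h2⟩ := h
  constructor
  · rcases h1 with ⟨h, h'⟩ | ⟨h, h'⟩ <;> nlinarith
  · rcases h2 with ⟨h, h'⟩ | ⟨h, h'⟩ <;> nlinarith

theorem pt_injOn : InjOn pt (Iio 34) := by
  have key : ∀ a < 34, ∀ b < 34, px a = px b → py a = py b → a = b := by decide
  intro a ha b hb h
  rw [pt, pt, Prod.mk.injEq, Nat.cast_inj, Nat.cast_inj] at h
  exact key a ha b hb h.1 h.2

/-- A family of 17 segments without circumscribing polygon. -/
noncomputable def family : Finset (Pt × Pt) := segs.toFinset.image fun s => (pt s.1, pt s.2)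

theorem mem_family {s : Pt × Pt} : s ∈ family ↔ ∃ t ∈ segs, (pt t.1, pt t.2) = s := by
  simp [family]

theorem lt_of_mem_segs : ∀ s ∈ segs, s.1 < 34 ∧ s.2 < 34 := by decide

theorem endpointSet_family : endpointSet family = pt '' Iio 34 := by
  have key : ∀ v < 34, ∃ s ∈ segs, v = s.1 ∨ v = s.2 := by decide
  ext p
  constructor
  · rintro ⟨_, hs, hp⟩
    obtain ⟨t, ht, rfl⟩ := mem_family.1 hs
    rcases hp with rfl | rfl
    · exact ⟨_, (lt_of_mem_segs t ht).1, rfl⟩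
    · exact ⟨_, (lt_of_mem_segs t ht).2, rfl⟩
  · rintro ⟨v, hv, rfl⟩
    obtain ⟨t, ht, h⟩ := key v hv
    exact ⟨_, mem_family.2 ⟨t, ht, rfl⟩, h.imp (congrArg pt) (congrArg pt)⟩

theorem card_family : family.card = 17 := by
  rw [family, Finset.card_image_of_injOn]
  · decide
  · have key : ∀ s ∈ segs, ∀ t ∈ segs, s.1 = t.1 → s = t := by decide
    intro s hs t ht h
    rw [Finset.mem_coe, List.mem_toFinset] at hs ht
    exact key s hs t ht (pt_injOn (lt_of_mem_segs s hs).1 (lt_of_mem_segs t ht).1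
      (congrArg Prod.fst h))

theorem axisParallel_family {s : Pt × Pt} (hs : s ∈ family) : s.1.1 = s.2.1 ∨ s.1.2 = s.2.2 := by
  have key : ∀ t ∈ segs, px t.1 = px t.2 ∨ py t.1 = py t.2 := by decide
  obtain ⟨t, ht, rfl⟩ := mem_family.1 hs
  exact (key t ht).imp (congrArg Nat.cast) (congrArg Nat.cast)

/-- The bounding boxes of the segments `s` and `t` are separated by a line. -/
def Separated (s t : ℕ × ℕ) : Prop :=
  max (px s.1) (px s.2) < min (px t.1) (px t.2) ∨ max (py s.1) (py s.2) < min (py t.1) (py t.2)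

instance (s t : ℕ × ℕ) : Decidable (Separated s t) := inferInstanceAs (Decidable (_ ∨ _))

theorem Separated.disjoint {s t : ℕ × ℕ} (h : Separated s t) :
    Disjoint (segment ℝ (pt s.1) (pt s.2)) (segment ℝ (pt t.1) (pt t.2)) := by
  rw [disjoint_left]
  intro x hs ht
  obtain ⟨hs1, hs2⟩ := Prod.segment_subset _ _ hs
  obtain ⟨ht1, ht2⟩ := Prod.segment_subset _ _ ht
  rw [segment_eq_uIcc] at hs1 hs2 ht1 ht2
  rcases h with h | h
  · have := ht1.1.trans hs1.2
    simp only [pt] at this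
    exact h.not_ge (by exact_mod_cast this)
  · have := ht2.1.trans hs2.2
    simp only [pt] at this
    exact h.not_ge (by exact_mod_cast this)

theorem pairwiseDisjointSegs_family : PairwiseDisjointSegs family := by
  constructor
  · intro s hs
    have key : ∀ t ∈ segs, t.1 ≠ t.2 := by decide
    obtain ⟨t, ht, rfl⟩ := mem_family.1 hs
    exact fun h => key t ht (pt_injOn (lt_of_mem_segs t ht).1 (lt_of_mem_segs t ht).2 h)
  · intro s hs t ht hst
    have key : ∀ s ∈ segs, ∀ t ∈ segs, s = t ∨ Separated s t ∨ Separated t s := by decide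
    obtain ⟨s', hs', rfl⟩ := mem_family.1 hs
    obtain ⟨t', ht', rfl⟩ := mem_family.1 ht
    rcases key s' hs' t' ht' with rfl | h | h
    · exact absurd rfl hst
    · exact h.disjoint
    · exact h.disjoint.symm

theorem not_collinear_family : ¬ Collinear ℝ (endpointSet family) := by
  rw [endpointSet_family]
  intro h
  have hmem : ∀ v < 34, pt v ∈ pt '' Iio 34 := fun v hv => ⟨v, hv, rfl⟩
  obtain ⟨d, hd⟩ := (collinear_iff_of_mem (hmem 0 (by norm_num))).1 h
  obtain ⟨r, hr⟩ := hd _ (hmem 1 (by norm_num))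
  obtain ⟨r', hr'⟩ := hd _ (hmem 2 (by norm_num))
  have h1 := congrArg Prod.fst hr
  have h2 := congrArg Prod.snd hr
  have h3 := congrArg Prod.fst hr'
  simp [pt, px, py, xs, ys] at h1 h2 h3
  rcases h1 with h | h
  · rw [h] at h2
    norm_num at h2
  · rw [h] at h3
    norm_num at h3

variable {P : SimplePolygon}

theorem exists_eq_vert (h : Circumscribes P family) (j : ZMod P.n) :
    ∃ v < 34, pt v = P.verts j := by
  have : P.verts j ∈ endpointSet family := h.1 ▸ mem_range_self j
  rwa [endpointSet_family] at this

theorem card_verts (h : Circumscribes P family) : P.n = 34 := by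
  have h1 := Nat.card_congr (Equiv.ofInjective _ P.inj)
  rw [Nat.card_zmod, h.1, endpointSet_family, Nat.card_coe_set_eq, pt_injOn.ncard_image] at h1
  rw [h1, ← Nat.card_coe_set_eq]
  simp

theorem edge_or_diagonal (h : Circumscribes P family) {v : ℕ} (hv : v < 34) :
    P.IsEdgeOf (pt v) (pt (partner v)) ∨
      openSegment ℝ (pt v) (pt (partner v)) ⊆ P.interiorRegion := by
  have key : ∀ v < 34, (v, partner v) ∈ segs ∨ (partner v, v) ∈ segs := by decide
  rcases key v hv with hs | hs
  · exact (h.2 _ (mem_family.2 ⟨_, hs, rfl⟩)).imp_right fun hd => hd.2.2.2.2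
  · rcases h.2 _ (mem_family.2 ⟨_, hs, rfl⟩) with ⟨i, hi⟩ | hd
    · exact Or.inl ⟨i, hi.symm⟩
    · right
      rw [openSegment_symm]
      exact hd.2.2.2.2

theorem notMem_interior_of_high (h : Circumscribes P family) {p : Pt} (hp : 57 ≤ p.2) :
    p ∉ P.interiorRegion := by
  have key : ∀ v < 34, py v ≤ 57 := by decide
  refine P.notMem_interiorRegion_of_le one_ne_zero (h := 57) (fun j => ?_) (by linarith)
  obtain ⟨v, hv, hj⟩ := exists_eq_vert h j
  have : (py v : ℝ) ≤ 57 := by exact_mod_cast key v hv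
  rw [← hj, one_mul]
  exact this

theorem notMem_interior_of_low (h : Circumscribes P family) {p : Pt} (hp : p.2 ≤ 1) :
    p ∉ P.interiorRegion := by
  have key : ∀ v < 34, 1 ≤ py v := by decide
  refine P.notMem_interiorRegion_of_le (σ := -1) (by norm_num) (h := -1) (fun j => ?_)
    (by linarith)
  obtain ⟨v, hv, hj⟩ := exists_eq_vert h j
  have : (1 : ℝ) ≤ py v := by exact_mod_cast key v hv
  rw [← hj, pt]
  linarith

theorem top_isEdgeOf (h : Circumscribes P family) : P.IsEdgeOf (pt 18) (pt 2) := by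
  refine (edge_or_diagonal h (v := 18) (by norm_num)).resolve_right fun hsub => ?_
  refine notMem_interior_of_high h (p := (50, 57)) le_rfl
    (hsub ⟨1 / 2, 1 / 2, by norm_num, by norm_num, by norm_num, ?_⟩)
  ext <;> simp [pt, px, py, xs, ys, partner] <;> norm_num

theorem bottom_isEdgeOf (h : Circumscribes P family) : P.IsEdgeOf (pt 3) (pt 19) := by
  refine (edge_or_diagonal h (v := 3) (by norm_num)).resolve_right fun hsub => ?_
  refine notMem_interior_of_low h (p := (50, 1)) le_rfl
    (hsub ⟨1 / 2, 1 / 2, by norm_num, by norm_num, by norm_num, ?_⟩)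
  ext <;> simp [pt, px, py, xs, ys, partner] <;> norm_num

theorem leftSector_of_coneBad {a b c t : Pt} {u v w : ℕ} (hu : pt u = a) (hv : pt v = b)
    (hw : pt w = c) (ht : pt (partner v) = t) (h : coneBad u v w = true) :
    LeftSector (b - a) (c - b) (t - b) := by
  subst hu hv hw ht
  have e1 := orient_eq_wedge (pt u) (pt v) (pt (partner v))
  have e2 := orient_eq_wedge' (pt v) (pt w) (pt (partner v))
  have e3 := orient_eq_wedge (pt u) (pt v) (pt w)
  rw [LeftSector, ← e1, ← e2, ← e3]
  rw [coneBad, Bool.and_eq_true] at h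
  have h2 := h.2
  by_cases hp : pos u v w = true
  · rw [hp, cond_true, Bool.and_eq_true, pos_iff_orient, pos_iff_orient] at h2
    exact Or.inl h2
  · have hp' := hp
    rw [Bool.not_eq_true] at hp'
    rw [hp', cond_false, Bool.or_eq_true, pos_iff_orient, pos_iff_orient] at h2
    rw [pos_iff_orient, not_lt] at hp
    exact Or.inr ⟨hp, h2⟩

theorem not_circumscribes_of_top {i : ZMod P.n} (h : Circumscribes P family)
    (hi : P.verts i = pt 18) (hi' : P.verts (i + 1) = pt 2) : False := by
  have hn := card_verts h
  choose g hg hgv using exists_eq_vert h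
  have hg_eq : ∀ j v, v < 34 → P.verts j = pt v → g j = v := fun j v hv hj =>
    pt_injOn (hg j) hv ((hgv j).trans hj)
  have h34 : ((34 : ℕ) : ZMod P.n) = 0 := by
    rw [← hn, ZMod.natCast_self]
  obtain ⟨f, hf⟩ : ∃ f : ℕ → ℕ, f = fun k : ℕ => g (i + 1 + k) := ⟨_, rfl⟩
  have hfv : ∀ k, pt (f k) = P.verts (i + 1 + k) := fun k => hf ▸ hgv _
  have hfv' : ∀ k, pt (f (k + 1)) = P.verts (i + 1 + k + 1) := fun k => by
    rw [hfv, Nat.cast_succ, add_assoc (i + 1)]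
  have hflt : ∀ k, f k < 34 := fun k => hf ▸ hg _
  have hcast : ∀ {a b : ℕ}, a < 34 → b < 34 → (a : ZMod P.n) = b → a = b := by
    intro a b ha hb hab
    rw [ZMod.natCast_eq_natCast_iff', hn, Nat.mod_eq_of_lt ha, Nat.mod_eq_of_lt hb] at hab
    exact hab
  have hk : ∀ p, 0 < wedge (P.edge i) (p - P.verts i) → p ∉ P.interiorRegion := by
    intro p hp
    refine notMem_interior_of_high h ?_
    rw [SimplePolygon.edge, hi, hi'] at hp
    simp [wedge, pt, px, py, xs, ys] at hp
    linarith
  refine Tour.false (f := f) ⟨fun k _ => hflt k, ?_, ?_, ?_, ?_, ?_, ?_, ?_⟩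
  · intro a ha b hb hab
    have := congrArg pt hab
    rw [hfv, hfv] at this
    exact hcast ha hb (add_left_cancel (P.inj this))
  · rw [hf]
    exact hg_eq _ _ (by norm_num) (by rw [Nat.cast_zero, add_zero, hi'])
  · rw [hf]
    refine hg_eq _ _ (by norm_num) ?_
    rw [← hi, add_assoc, add_comm (1 : ZMod P.n), ← Nat.cast_succ, h34, add_zero]
  · intro k _
    rw [sees_iff]
    intro s hs
    rw [Bool.eq_false_iff]
    intro hc
    have hc := crosses_of_cr hc
    rw [hfv, hfv'] at hc
    exact P.not_crosses_of_edge_or_diagonal _ (h.2 _ (mem_family.2 ⟨s, hs, rfl⟩)) hc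
  · intro k _ l _
    rw [Bool.eq_false_iff]
    intro hc
    have hc := crosses_of_cr hc
    rw [hfv, hfv', hfv, hfv'] at hc
    exact P.not_crosses_edges _ _ hc
  · intro k _
    rw [Bool.eq_false_iff]
    intro hc
    have hsec := leftSector_of_coneBad (hfv k) (hfv' k) (hfv (k + 2)) rfl hc
    have hne : f k ≠ partner (f (k + 1)) ∧ f (k + 2) ≠ partner (f (k + 1)) := by
      simp only [coneBad, Bool.and_eq_true, Bool.not_eq_true', beq_eq_false] at hc
      exact ⟨hc.1.1.symm, hc.1.2.symm⟩
    have e1 : i + 1 + ((k + 2 : ℕ) : ZMod P.n) = i + 1 + k + 1 + 1 := by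
      push_cast
      ring
    rw [e1] at hsec
    obtain ⟨j, hj⟩ : ∃ j, j = i + 1 + (k : ZMod P.n) + 1 := ⟨_, rfl⟩
    have hj1 : P.verts (i + 1 + k) = P.verts (j - 1) := by rw [hj, add_sub_cancel_right]
    rcases edge_or_diagonal h (hflt (k + 1)) with ⟨l, ⟨h1, h2⟩ | ⟨h1, h2⟩⟩ | hsub
    · rw [hfv'] at h1
      rw [← P.inj h1, ← e1, ← hfv] at h2
      exact hne.2 (pt_injOn (hflt _) (partner_lt (hflt _)) h2.symm)
    · rw [hfv'] at h2
      rw [← add_right_cancel (P.inj h2), ← hfv] at h1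
      exact hne.1 (pt_injOn (hflt _) (partner_lt (hflt _)) h1.symm)
    · rw [hfv', ← hj] at hsub
      refine P.not_openSegment_subset_interiorRegion hk j ?_ hsub
      rw [SimplePolygon.edge, SimplePolygon.edge, sub_add_cancel, ← hj1, hj]
      exact hsec
  · have base : ∀ l a b, a < 34 → b < 34 → a ≠ 18 → P.verts l = pt a → P.verts (l + 1) = pt b →
        ∃ k < 33, f k = a ∧ f (k + 1) = b := by
      intro l a b ha hb ha18 hla hlb
      have hlk : i + 1 + ((l - (i + 1)).val : ZMod P.n) = l := by simp
      have hlt : (l - (i + 1)).val < 34 := hn ▸ ZMod.val_lt _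
      generalize (l - (i + 1)).val = k at hlk hlt
      refine ⟨k, ?_, pt_injOn (hflt _) ha ?_, pt_injOn (hflt _) hb ?_⟩
      · by_contra hk33
        obtain rfl : k = 33 := by omega
        rw [add_assoc, add_comm (1 : ZMod P.n), ← Nat.cast_succ, h34, add_zero] at hlk
        subst hlk
        exact ha18 (pt_injOn ha (by simp) (hla.symm.trans hi))
      · rw [hfv, hlk, hla]
      · rw [hfv', hlk, hlb]
    obtain ⟨l, ⟨h1, h2⟩ | ⟨h1, h2⟩⟩ := bottom_isEdgeOf h
    · obtain ⟨k, hk, hk'⟩ := base l 3 19 (by norm_num) (by norm_num) (by norm_num) h1.symm h2.symm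
      exact ⟨k, hk, Or.inl hk'⟩
    · obtain ⟨k, hk, hk'⟩ := base l 19 3 (by norm_num) (by norm_num) (by norm_num) h1.symm h2.symm
      exact ⟨k, hk, Or.inr hk'⟩

theorem not_circumscribes (P : SimplePolygon) : ¬ Circumscribes P family := by
  intro h
  obtain ⟨i, ⟨h1, h2⟩ | ⟨h1, h2⟩⟩ := top_isEdgeOf h
  · exact not_circumscribes_of_top h h1.symm h2.symm
  · refine not_circumscribes_of_top (P := P.reverse) (i := (-(i + 1) : ZMod P.n))
      (P.reverse_circumscribes h) ?_ ?_
    · change P.verts (-(-(i + 1))) = pt 18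
      rw [neg_neg, h2]
    · change P.verts (-(-(i + 1) + 1)) = pt 2
      rw [SimplePolygon.neg_add_one_add_one, neg_neg, h1]

end Config

/-- There is a family of `17` pairwise disjoint closed axis-parallel segments in the
plane, not all contained in one line, admitting no circumscribing polygon. -/
theorem exists_17_segments_no_circumscribing_polygon :
    ∃ S : Finset (Pt × Pt),
      S.card = 17 ∧
      (∀ s ∈ S, (s.1).1 = (s.2).1 ∨ (s.1).2 = (s.2).2) ∧
      PairwiseDisjointSegs S ∧
      ¬ Collinear ℝ (endpointSet S) ∧
      ¬ ∃ P : SimplePolygon, Circumscribes P S :=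
  ⟨Config.family, Config.card_family, fun _ => Config.axisParallel_family,
    Config.pairwiseDisjointSegs_family, Config.not_collinear_family,
    fun ⟨P, hP⟩ => Config.not_circumscribes P hP⟩
end
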